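/- Gromov's non-squeezing theorem: for every n ≥ 1 and all real numbers r, R > 0, there exists a symplectic embedding of the open ball of capacity r, B^{2n}(r) = {z ∈ ℂⁿ : π·Σ_{k=1}^n |z_k|² < r}, into the cylinder Z^{2n}(R) = {z ∈ ℂⁿ : π·|z₁|² < R} if and only if r ≤ R. -/

import Mathlib

open MeasureTheory Real

/-- The standard symplectic form on `ℂⁿ ≅ ℝ^{2n}`:
`ω_std(v,w) = Σ_k (Re v_k · Im w_k − Im v_k · Re w_k)`. -/
noncomputable def omegaStd (n : ℕ) (v w : EuclideanSpace ℂ (Fin n)) : ℝ :=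
  ∑ k, ((v k).re * (w k).im - (v k).im * (w k).re)

/-- A symplectic embedding from `U` to `V`: a smooth injective map `ψ : U → V`
whose derivative preserves the standard symplectic form at every point of `U`. -/
def IsSymplecticEmbedding (n : ℕ) (U V : Set (EuclideanSpace ℂ (Fin n)))
    (ψ : EuclideanSpace ℂ (Fin n) → EuclideanSpace ℂ (Fin n)) : Prop :=
  ContDiffOn ℝ (⊤ : ℕ∞) ψ U ∧ Set.InjOn ψ U ∧ Set.MapsTo ψ U V ∧
    ∀ x ∈ U, ∀ v w, omegaStd n (fderiv ℝ ψ x v) (fderiv ℝ ψ x w) = omegaStd n v w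

namespace GNS

lemma det_poly {E : Type*} [NormedAddCommGroup E] [NormedSpace ℝ E] [FiniteDimensional ℝ E]
    (A : E →L[ℝ] E) : ∃ p : Polynomial ℝ, p.natDegree ≤ Module.finrank ℝ E ∧
      ∀ t : ℝ, (ContinuousLinearMap.id ℝ E + t • A).det = p.eval t := by
  classical
  let b := Module.finBasis ℝ E
  let M := LinearMap.toMatrix b b (A : E →ₗ[ℝ] E)
  refine ⟨Matrix.det ((Polynomial.X : Polynomial ℝ) • M.map Polynomial.C + (1 : Matrix _ _ ℝ).map Polynomial.C), ?_, ?_⟩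
  · simpa using Polynomial.natDegree_det_X_add_C_le M 1
  · intro t
    have : ((ContinuousLinearMap.id ℝ E + t • A).det) = LinearMap.det (((ContinuousLinearMap.id ℝ E + t • A : E →L[ℝ] E)) : E →ₗ[ℝ] E) := rfl
    rw [this, ← LinearMap.det_toMatrix b, ← Polynomial.coe_evalRingHom, RingHom.map_det]
    congr 1
    ext i j
    simp [M, LinearMap.toMatrix_apply, Matrix.one_apply, Finsupp.single_apply]
    have h0 : (if j = i then (1:ℝ) else 0) = Polynomial.eval t (if i = j then 1 else 0) := by
      by_cases h : i = j
      · subst h; rw [if_pos rfl, if_pos rfl]; exact (Polynomial.eval_one).symm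
      · have h' : ¬ j = i := fun e => h e.symm
        rw [if_neg h, if_neg h']; exact (Polynomial.eval_zero).symm
    rw [h0]; ring

lemma det_ne_zero_of_norm {E : Type*} [NormedAddCommGroup E] [NormedSpace ℝ E] [FiniteDimensional ℝ E]
    (A : E →L[ℝ] E) (hA : ‖A‖ < 1) : (ContinuousLinearMap.id ℝ E + A).det ≠ 0 := by
  have h1 : ∀ x, (ContinuousLinearMap.id ℝ E + A) x = 0 → x = 0 := by
    intro x hx
    have h2 : x = - A x := by
      have : x + A x = 0 := by simpa using hx
      exact eq_neg_of_add_eq_zero_left this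
    have h3 : ‖x‖ ≤ ‖A‖ * ‖x‖ := by
      calc ‖x‖ = ‖A x‖ := by rw [← norm_neg (A x), ← h2]
        _ ≤ _ := A.le_opNorm x
    by_contra hne
    have : 0 < ‖x‖ := norm_pos_iff.mpr hne
    nlinarith
  intro h0
  have h0' : LinearMap.det ((ContinuousLinearMap.id ℝ E + A : E →L[ℝ] E) : E →ₗ[ℝ] E) = 0 := h0
  have h5 := LinearMap.bot_lt_ker_of_det_eq_zero h0'
  apply h5.ne'
  rw [LinearMap.ker_eq_bot']
  exact h1

lemma det_pos_of_norm {E : Type*} [NormedAddCommGroup E] [NormedSpace ℝ E] [FiniteDimensional ℝ E]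
    (A : E →L[ℝ] E) (hA : ‖A‖ < 1) : 0 < (ContinuousLinearMap.id ℝ E + A).det := by
  obtain ⟨p, -, hp⟩ := det_poly A
  by_contra hneg
  push Not at hneg
  have e1 : p.eval 1 ≤ 0 := by rw [← hp 1]; simpa using hneg
  have e0 : 0 ≤ p.eval 0 := by rw [← hp 0]; simp [ContinuousLinearMap.det]
  have hc : ContinuousOn (fun t => p.eval t) (Set.Icc (0:ℝ) 1) := p.continuous.continuousOn
  have := intermediate_value_Icc' (zero_le_one) hc
  obtain ⟨t, ht, ht0⟩ := this ⟨e1, e0⟩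
  have ht0 : p.eval t = 0 := ht0
  rw [← hp t] at ht0
  refine det_ne_zero_of_norm (t • A) ?_ ht0
  rw [norm_smul, Real.norm_eq_abs, abs_of_nonneg ht.1]
  nlinarith [ht.2, norm_nonneg A, ht.1]

lemma no_retraction {E : Type*} [NormedAddCommGroup E] [InnerProductSpace ℝ E] [FiniteDimensional ℝ E]
    (r : E → E) (hr : ContDiff ℝ 1 r) (M : ℝ) (hM : 0 < M)
    (h1 : ∀ u, ‖u‖ = M → r u = u) (h2 : ∀ u, ‖r u‖ = M) : False := by
  classical
  borelize E
  let μ : Measure E := Measure.addHaar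
  have hdiff : Differentiable ℝ r := hr.differentiable (by norm_num)
  have hcont' : Continuous (fderiv ℝ r) := hr.continuous_fderiv (by norm_num)
  let B : E → E →L[ℝ] E := fun u => fderiv ℝ r u - ContinuousLinearMap.id ℝ E
  have hBc : Continuous B := hcont'.sub continuous_const
  obtain ⟨C0, hC0⟩ := (isCompact_closedBall (0:E) M).exists_bound_of_continuousOn hBc.continuousOn
  let C : ℝ := max C0 1
  have hC : ∀ u ∈ Metric.closedBall (0:E) M, ‖B u‖ ≤ C := fun u hu => (hC0 u hu).trans (le_max_left _ _)
  have hCpos : 0 < C := lt_of_lt_of_le one_pos (le_max_right _ _)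
  let h : E → E := fun u => r u - u
  have hhd : ∀ u, HasFDerivAt h (B u) u := fun u => (hdiff u).hasFDerivAt.sub (hasFDerivAt_id u)
  have hlip : ∀ u ∈ Metric.closedBall (0:E) M, ∀ v ∈ Metric.closedBall (0:E) M, ‖h v - h u‖ ≤ C * ‖v - u‖ := by
    intro u hu v hv
    exact (convex_closedBall (0:E) M).norm_image_sub_le_of_norm_hasFDerivWithin_le
      (fun x _ => (hhd x).hasFDerivWithinAt) hC hu hv
  let k : E → E := fun u => if ‖u‖ ≤ M then h u else 0
  have hk2 : ∀ u w, ‖u‖ ≤ M → ¬ ‖w‖ ≤ M → ‖h u‖ ≤ 2 * C * ‖u - w‖ := by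
    intro u w hu hw
    push Not at hw
    have hw0 : 0 < ‖w‖ := hM.trans hw
    let z : E := (M / ‖w‖) • w
    have hz : ‖z‖ = M := by
      simp only [z, norm_smul, Real.norm_eq_abs, abs_div, abs_norm, abs_of_pos hM]
      field_simp
    have hz0 : h z = 0 := by simp [h, h1 z hz]
    have hzw : ‖w - z‖ = ‖w‖ - M := by
      have : w - z = (1 - M/‖w‖) • w := by simp [z, sub_smul]
      rw [this, norm_smul, Real.norm_eq_abs, abs_of_nonneg]
      · field_simp
      · rw [sub_nonneg, div_le_one hw0]; exact hw.le
    have h3 := hlip z (by simp [hz]) u (by simpa using hu)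
    rw [hz0, sub_zero] at h3
    have h4 : ‖u - z‖ ≤ ‖u - w‖ + ‖w - z‖ := by
      have := norm_add_le (u-w) (w-z); simpa using this
    have h5 : ‖w‖ ≤ ‖u - w‖ + ‖u‖ := by
      have := norm_sub_norm_le w u
      rw [norm_sub_rev] at this; linarith
    by_cases h6 : ‖w‖ - M ≤ ‖u - w‖
    · nlinarith
    · -- cannot be settled by norm alone, use a point on the segment
      nlinarith [hlip z (by simp [hz]) u (by simpa using hu), norm_sub_norm_le w u, norm_sub_rev u w]
  have hk : ∀ u w, ‖k u - k w‖ ≤ 2 * C * ‖u - w‖ := by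
    intro u w
    by_cases hu : ‖u‖ ≤ M <;> by_cases hw : ‖w‖ ≤ M
    · simp only [k, hu, hw, if_true]
      have := hlip w (by simpa using hw) u (by simpa using hu)
      nlinarith [norm_nonneg (u - w)]
    · simp only [k, hu, hw, if_true, if_false, sub_zero]
      exact hk2 u w hu hw
    · simp only [k, hu, hw, if_true, if_false, zero_sub, norm_neg]
      rw [norm_sub_rev u w]; exact hk2 w u hw hu
    · simp only [k, hu, hw, if_false, sub_zero, norm_zero]; positivity
  -- the integrals
  let D : ℝ → E → ℝ := fun t u => (ContinuousLinearMap.id ℝ E + t • B u).det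
  have hDc : ∀ t, Continuous (D t) := by
    intro t
    exact ContinuousLinearMap.continuous_det.comp (continuous_const.add (hBc.const_smul t))
  have hInt : ∀ t, IntegrableOn (D t) (Metric.ball (0:E) M) μ := by
    intro t
    exact ((hDc t).continuousOn.integrableOn_compact (isCompact_closedBall (0:E) M)).mono_set Metric.ball_subset_closedBall
  have hvol : ∀ t, 0 < t → t * (2 * C) < 1 → ∫ u in Metric.ball (0:E) M, D t u ∂μ = μ.real (Metric.ball (0:E) M) := by
    intro t ht htC
    let g : E → E := fun u => u + t • k u
    have hginj : Function.Injective g := by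
      intro u w huw
      have h3 : u - w = - (t • (k u - k w)) := by
        simp only [g] at huw
        rw [smul_sub]
        have : u - w = t • k w - t • k u := by
          rw [sub_eq_sub_iff_add_eq_add, huw]; abel
        rw [this]; abel
      have h4 : ‖u - w‖ ≤ t * (2 * C) * ‖u - w‖ := by
        calc ‖u - w‖ = ‖t • (k u - k w)‖ := by rw [h3, norm_neg]
          _ = t * ‖k u - k w‖ := by rw [norm_smul, Real.norm_eq_abs, abs_of_pos ht]
          _ ≤ t * (2 * C * ‖u - w‖) := by gcongr; exact hk u w
          _ = _ := by ring
      by_contra hne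
      have : 0 < ‖u - w‖ := norm_pos_iff.mpr (sub_ne_zero.mpr hne)
      nlinarith
    have hgsurj : Function.Surjective g := by
      intro v
      have hcw : ContractingWith (Real.toNNReal (t * (2*C))) (fun u => v - t • k u) := by
        constructor
        · rw [← NNReal.coe_lt_coe, Real.coe_toNNReal _ (by positivity)]; simpa using htC
        · refine LipschitzWith.of_dist_le_mul fun u w => ?_
          rw [Real.coe_toNNReal _ (by positivity), dist_eq_norm, dist_eq_norm]
          have : v - t • k u - (v - t • k w) = - (t • (k u - k w)) := by rw [smul_sub]; abel
          rw [this, norm_neg, norm_smul, Real.norm_eq_abs, abs_of_pos ht, mul_assoc]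
          gcongr; exact hk u w
      refine ⟨ContractingWith.fixedPoint _ hcw, ?_⟩
      have := hcw.fixedPoint_isFixedPt
      unfold Function.IsFixedPt at this
      have this' : v - t • k (ContractingWith.fixedPoint _ hcw) = ContractingWith.fixedPoint _ hcw := this
      generalize ContractingWith.fixedPoint _ hcw = y at this'
      change y + t • k y = v
      rw [← sub_eq_iff_eq_add.mp this']
    have hk0 : ∀ u, M ≤ ‖u‖ → k u = 0 := by
      intro u hu
      by_cases h3 : ‖u‖ ≤ M
      · simp only [k, h3, if_true, h]; rw [h1 u (le_antisymm h3 hu)]; simp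
      · simp [k, h3]
    have himg : g '' Metric.ball (0:E) M = Metric.ball (0:E) M := by
      ext v
      constructor
      · rintro ⟨u, hu, rfl⟩
        by_contra hv
        have hv' : M ≤ ‖g u‖ := by simpa using hv
        have : g (g u) = g u := by simp [g, hk0 _ hv']
        have := hginj this
        rw [this] at hv
        exact hv hu
      · intro hv
        obtain ⟨u, rfl⟩ := hgsurj v
        refine ⟨u, ?_, rfl⟩
        by_contra hu
        have hu' : M ≤ ‖u‖ := by simpa using hu
        have : g u = u := by simp [g, hk0 _ hu']
        rw [this] at hv
        exact hu hv
    have hgd : ∀ u ∈ Metric.ball (0:E) M, HasFDerivWithinAt g (ContinuousLinearMap.id ℝ E + t • B u) (Metric.ball (0:E) M) u := by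
      intro u hu
      have h3 : HasFDerivWithinAt (fun u => u + t • h u) (ContinuousLinearMap.id ℝ E + t • B u) (Metric.ball (0:E) M) u :=
        ((hasFDerivAt_id u).add ((hhd u).const_smul t)).hasFDerivWithinAt
      refine h3.congr ?_ ?_
      · intro x hx
        have : ‖x‖ ≤ M := by simpa using (Metric.ball_subset_closedBall hx)
        simp [g, k, this]
      · have : ‖u‖ ≤ M := by simpa using (Metric.ball_subset_closedBall hu)
        simp [g, k, this]
    have h5 := integral_image_eq_integral_abs_det_fderiv_smul μ measurableSet_ball hgd hginj.injOn (fun _ => (1:ℝ))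
    rw [himg] at h5
    simp only [smul_eq_mul, mul_one, integral_const, measureReal_restrict_apply_univ] at h5
    rw [h5]
    refine setIntegral_congr_fun measurableSet_ball fun u hu => ?_
    refine (abs_of_pos ?_).symm
    apply det_pos_of_norm
    rw [norm_smul, Real.norm_eq_abs, abs_of_pos ht]
    have := hC u (Metric.ball_subset_closedBall hu)
    nlinarith
  -- at time one the determinant vanishes
  have hD1 : ∀ u, D 1 u = 0 := by
    intro u
    have e : ContinuousLinearMap.id ℝ E + (1:ℝ) • B u = fderiv ℝ r u := by simp [B]
    simp only [D, e]
    by_contra hne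
    have hsurj : Function.Surjective (fderiv ℝ r u) := by
      have h6 : IsUnit (LinearMap.det ((fderiv ℝ r u : E →L[ℝ] E) : E →ₗ[ℝ] E)) := isUnit_iff_ne_zero.mpr hne
      exact (LinearEquiv.ofIsUnitDet (v := Module.finBasis ℝ E) (v' := Module.finBasis ℝ E) (f := ((fderiv ℝ r u : E →L[ℝ] E) : E →ₗ[ℝ] E)) (by simpa using h6)).surjective
    obtain ⟨v, hv⟩ := hsurj (r u)
    have h7 : HasFDerivAt (fun u => inner ℝ (r u) (r u)) (0 : E →L[ℝ] ℝ) u := by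
      have : (fun u => inner ℝ (r u) (r u)) = fun _ => M^2 := by
        ext u; rw [real_inner_self_eq_norm_sq, h2]
      rw [this]; exact hasFDerivAt_const _ _
    have h8 := (hdiff u).hasFDerivAt.inner ℝ (hdiff u).hasFDerivAt
    have h9 := congrArg (fun L => L v) (h8.unique h7)
    simp [hv, h2] at h9
    exact hM.ne' h9
  -- interpolation
  let d := Module.finrank ℝ E
  let t0 : ℝ := 1 / (4 * C)
  have ht0 : 0 < t0 := by positivity
  let nd : ℕ → ℝ := fun i => t0 / (i + 1)
  have hnd : Set.InjOn nd (Finset.range (d+1)) := by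
    intro i _ j _ hij
    simp only [nd] at hij
    field_simp at hij
    have : (i:ℝ) = j := by linarith
    exact_mod_cast this
  let S := Finset.range (d+1)
  have hkey : ∀ u, D 1 u = ∑ i ∈ S, D (nd i) u * (Lagrange.basis S nd i).eval 1 := by
    intro u
    obtain ⟨p, hpd, hp⟩ := det_poly (B u)
    have hdeg : p.degree < S.card := by
      rw [Finset.card_range]
      refine lt_of_le_of_lt Polynomial.degree_le_natDegree ?_
      exact_mod_cast Nat.lt_succ_of_le hpd
    have h10 := congrArg (Polynomial.eval 1) (Lagrange.eq_interpolate hnd hdeg)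
    rw [Lagrange.interpolate_apply, Polynomial.eval_finsetSum] at h10
    simp only [Polynomial.eval_mul, Polynomial.eval_C] at h10
    simp only [D, hp]
    exact h10
  have hfin : ∫ u in Metric.ball (0:E) M, D 1 u ∂μ = μ.real (Metric.ball (0:E) M) := by
    simp_rw [hkey]
    rw [integral_finsetSum]
    · have : ∀ i ∈ S, ∫ u in Metric.ball (0:E) M, D (nd i) u * (Lagrange.basis S nd i).eval 1 ∂μ
          = μ.real (Metric.ball (0:E) M) * (Lagrange.basis S nd i).eval 1 := by
        intro i _
        rw [integral_mul_const, hvol (nd i) (by positivity)]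
        simp only [nd, t0]
        have : (0:ℝ) ≤ i := Nat.cast_nonneg i
        rw [div_div, div_mul_eq_mul_div, div_lt_one (by positivity)]
        nlinarith
      rw [Finset.sum_congr rfl this, ← Finset.mul_sum, ← Polynomial.eval_finsetSum,
        Lagrange.sum_basis hnd ⟨0, by simp⟩]
      simp
    · intro i _
      exact (hInt (nd i)).mul_const _
  simp only [hD1, integral_zero] at hfin
  have hpos : 0 < μ.real (Metric.ball (0:E) M) := by
    rw [Measure.real, ENNReal.toReal_pos_iff]
    exact ⟨Metric.measure_ball_pos μ 0 hM, measure_ball_lt_top⟩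
  linarith

/-- A continuous self-map equal to a translate of the identity near infinity has a zero. -/
lemma exists_zero_inner {E : Type*} [NormedAddCommGroup E] [InnerProductSpace ℝ E] [FiniteDimensional ℝ E]
    (G : E → E) (hG : Continuous G) (τ : ℝ) (hτ : 0 < τ) (h : ∀ u, τ ≤ ‖u‖ → G u = u) :
    ∃ u, G u = 0 := by
  by_contra hno
  push Not at hno
  let f : E → E := fun u => G u - u
  have hf : Continuous f := hG.sub continuous_id
  have hf0 : ∀ u, τ ≤ ‖u‖ → f u = 0 := fun u hu => by simp [f, h u hu]
  have hfs : HasCompactSupport f := by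
    refine HasCompactSupport.intro (isCompact_closedBall (0:E) τ) fun u hu => hf0 u ?_
    have : τ < ‖u‖ := by simpa using hu
    exact this.le
  have huc : UniformContinuous f := hfs.uniformContinuous_of_continuous hf
  obtain ⟨m, hm, hm'⟩ : ∃ m > 0, ∀ u, m ≤ ‖G u‖ := by
    obtain ⟨u0, -, hu0⟩ := (isCompact_closedBall (0:E) τ).exists_isMinOn ⟨0, by simp [hτ.le]⟩ hG.norm.continuousOn
    refine ⟨min τ ‖G u0‖, lt_min hτ (norm_pos_iff.mpr (hno u0)), fun u => ?_⟩
    by_cases hu : ‖u‖ ≤ τ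
    · exact (min_le_right _ _).trans (hu0 (by simpa using hu))
    · push Not at hu
      rw [h u hu.le]; exact (min_le_left _ _).trans hu.le
  obtain ⟨δ, hδ, hfδ⟩ := Metric.uniformContinuous_iff.mp huc (m/2) (by positivity)
  obtain ⟨g, hgc, hg⟩ := hf.exists_contDiff_dist_le_of_forall_mem_ball_dist_le hδ
  have hg1 : ∀ a, dist (g a) (f a) ≤ m/2 := fun a => hg a _ fun x hx => (hfδ hx).le
  have hg2 : ∀ a, τ + δ ≤ ‖a‖ → g a = 0 := by
    intro a ha
    have := hg a 0 (fun x hx => ?_)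
    · rw [hf0 a (by linarith)] at this
      exact dist_le_zero.mp this
    · have h3 : ‖a‖ ≤ ‖x‖ + dist x a := by
        rw [dist_eq_norm]
        have := norm_sub_norm_le a x
        rw [norm_sub_rev] at this; linarith
      have h4 : dist x a < δ := hx
      rw [hf0 a (by linarith), hf0 x (by linarith)]; simp
  have hne : ∀ a, a + g a ≠ 0 := by
    intro a h0
    have h3 := hm' a
    have h4 := hg1 a
    rw [dist_eq_norm] at h4
    have : g a - f a = - G a := by
      have : g a = -a := (eq_neg_of_add_eq_zero_right h0)
      simp only [f, this]; abel
    rw [this, norm_neg] at h4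
    linarith
  let M := τ + δ
  have hM : 0 < M := by positivity
  refine no_retraction (fun a => (M / ‖a + g a‖) • (a + g a)) ?_ M hM ?_ ?_
  · have hc : ContDiff ℝ 1 (fun a => a + g a) := contDiff_id.add (hgc.of_le (by exact_mod_cast le_top))
    exact ContDiff.smul (contDiff_const.div (hc.norm ℝ hne) (fun x => norm_ne_zero_iff.mpr (hne x))) hc
  · intro u hu
    have : g u = 0 := hg2 u hu.ge
    simp only [this, add_zero, hu]
    rw [div_self hM.ne', one_smul]
  · intro u
    rw [norm_smul, Real.norm_eq_abs, abs_div, abs_norm, abs_of_pos hM]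
    have : ‖u + g u‖ ≠ 0 := norm_ne_zero_iff.mpr (hne u)
    field_simp

lemma exists_zero {F : Type*} [NormedAddCommGroup F] [NormedSpace ℝ F] [FiniteDimensional ℝ F]
    (G : F → F) (hG : Continuous G) (u0 : F) (τ : ℝ) (h : ∀ u, τ ≤ ‖u‖ → G u = u - u0) :
    ∃ u, G u = 0 := by
  let e : F ≃L[ℝ] EuclideanSpace ℝ (Fin (Module.finrank ℝ F)) := toEuclidean
  let K := ‖(e.symm : EuclideanSpace ℝ (Fin (Module.finrank ℝ F)) →L[ℝ] F)‖
  have hK : 0 ≤ K := norm_nonneg _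
  obtain ⟨v, hv⟩ := exists_zero_inner (fun v => e (G (e.symm v + u0)))
    (e.continuous.comp (hG.comp (e.symm.continuous.add continuous_const)))
    ((‖(e : F →L[ℝ] EuclideanSpace ℝ (Fin (Module.finrank ℝ F)))‖ + 1) * (|τ| + ‖u0‖ + 1)) (by positivity) (by
      intro v hv
      rw [h]
      · simp
      · have h1 : ‖v‖ ≤ ‖(e : F →L[ℝ] EuclideanSpace ℝ (Fin (Module.finrank ℝ F)))‖ * ‖e.symm v‖ := by
          have := (e : F →L[ℝ] EuclideanSpace ℝ (Fin (Module.finrank ℝ F))).le_opNorm (e.symm v)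
          simpa using this
        set L := ‖(e : F →L[ℝ] EuclideanSpace ℝ (Fin (Module.finrank ℝ F)))‖
        have hL : 0 ≤ L := norm_nonneg _
        have h2 : |τ| + ‖u0‖ + 1 ≤ ‖e.symm v‖ := by
          by_contra hlt
          push Not at hlt
          have := norm_nonneg (e.symm v)
          nlinarith [abs_nonneg τ, norm_nonneg u0]
        have h3 : ‖e.symm v‖ ≤ ‖e.symm v + u0‖ + ‖u0‖ := by
          have := norm_sub_le (e.symm v + u0) u0
          simpa using this
        linarith [le_abs_self τ])
  exact ⟨e.symm v + u0, by simpa using hv⟩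

end GNS

namespace GNS

lemma minimax {E W : Type*} [NormedAddCommGroup E] [InnerProductSpace ℝ E]
    [NormedAddCommGroup W] [NormedSpace ℝ W] [FiniteDimensional ℝ W]
    (a : E → ℝ) (g : E → E) (ha : Continuous a) (hg : Continuous g) (L : ℝ) (hLpos : 0 < L)
    (hL : ∀ x v, a (x + v) ≤ a x + inner ℝ (g x) v + L * ‖v‖ ^ 2)
    (j : W × ℝ → E) (hj : Continuous j) (Pr : E → W) (hPrc : Continuous Pr)
    (Nm : E → ℝ) (hNmc : Continuous Nm)
    (hPr : ∀ w s, Pr (j (w, s)) = w) (hNm : ∀ w s, 0 ≤ s → Nm (j (w, s)) = s)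
    (w0 : W) (ρ α τ : ℝ) (hρ : 0 < ρ) (hα : 0 < α)
    (h0 : ∀ w, a (j (w, 0)) ≤ 0) (hτ : ∀ w s, 0 ≤ s → τ ≤ ‖(w, s)‖ → a (j (w, s)) ≤ 0)
    (hΓ : ∀ x, Pr x = w0 → Nm x = ρ → α ≤ a x) (ε : ℝ) (hε : 0 < ε) :
    ∃ x, α ≤ a x ∧ ‖g x‖ < ε := by
  by_contra hcon
  push Not at hcon
  let χ : ℝ → ℝ := fun y => max 0 (min 1 (y / α))
  have hχc : Continuous χ := by fun_prop
  have hχ0 : ∀ y, 0 ≤ χ y := fun y => le_max_left _ _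
  have hχ1 : ∀ y, χ y ≤ 1 := fun y => max_le zero_le_one (min_le_left _ _)
  have hχz : ∀ y, y ≤ 0 → χ y = 0 := by
    intro y hy
    refine max_eq_left ((min_le_right _ _).trans ?_)
    exact div_nonpos_of_nonpos_of_nonneg hy hα.le
  have hχo : ∀ y, α ≤ y → χ y = 1 := by
    intro y hy
    have : 1 ≤ y / α := by rwa [le_div_iff₀ hα, one_mul]
    simp [χ, min_eq_left this]
  let σ : ℝ := 1 / (2 * L)
  have hσ : 0 < σ := by positivity
  let η : E → E := fun x => x - (σ * χ (a x)) • g x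
  have hηc : Continuous η := by fun_prop
  have hηfix : ∀ x, a x ≤ 0 → η x = x := by
    intro x hx; simp [η, hχz _ hx]
  have hdesc : ∀ x, a (η x) ≤ a x - (σ * χ (a x)) / 2 * ‖g x‖ ^ 2 := by
    intro x
    have h1 := hL x (-((σ * χ (a x)) • g x))
    rw [← sub_eq_add_neg] at h1
    set s := σ * χ (a x) with hs
    have hs0 : 0 ≤ s := mul_nonneg hσ.le (hχ0 _)
    have hs1 : s ≤ σ := by rw [hs]; nlinarith [hχ1 (a x)]
    have h2 : L * s ≤ 1 / 2 := by
      have : L * σ = 1/2 := by simp only [σ]; field_simp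
      nlinarith
    rw [inner_neg_right, inner_smul_right, real_inner_self_eq_norm_sq, norm_neg, norm_smul,
      Real.norm_eq_abs, abs_of_nonneg hs0] at h1
    have h3 : L * (s * ‖g x‖) ^ 2 ≤ s / 2 * ‖g x‖ ^ 2 := by
      have : L * (s * ‖g x‖) ^ 2 = (L * s) * (s * ‖g x‖ ^ 2) := by ring
      rw [this]
      have : 0 ≤ s * ‖g x‖ ^ 2 := by positivity
      nlinarith
    have h4 : a (η x) = a (x - s • g x) := rfl
    rw [h4]; linarith
  have hmono : ∀ x, a (η x) ≤ a x := by
    intro x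
    have h1 := hdesc x
    have : 0 ≤ σ * χ (a x) := mul_nonneg hσ.le (hχ0 _)
    have : 0 ≤ σ * χ (a x) / 2 * ‖g x‖ ^ 2 := by positivity
    linarith
  have hiter : ∀ (k : ℕ) x, α ≤ a (η^[k] x) → a (η^[k] x) ≤ a x - k * (σ / 2 * ε ^ 2) := by
    intro k
    induction k with
    | zero => intro x _; simp
    | succ k ih =>
      intro x hx
      rw [Function.iterate_succ_apply'] at hx ⊢
      have h1 : α ≤ a (η^[k] x) := hx.trans (hmono _)
      have h2 := ih x h1
      have h3 := hdesc (η^[k] x)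
      rw [hχo _ h1, mul_one] at h3
      have h4 := hcon _ h1
      have h5 : σ / 2 * ε ^ 2 ≤ σ / 2 * ‖g (η^[k] x)‖ ^ 2 := by gcongr
      push_cast
      linarith
  have hiterfix : ∀ (k : ℕ) x, a x ≤ 0 → η^[k] x = x := by
    intro k x hx
    exact Function.iterate_fixed (hηfix x hx) k
  -- intersection property
  have hintg : ∀ k : ℕ, ∃ w s, 0 ≤ s ∧ α ≤ a (η^[k] (j (w, s))) := by
    intro k
    let γ : E → E := η^[k]
    have hγc : Continuous γ := hηc.iterate k
    let G : W × ℝ → W × ℝ := fun u =>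
      (Pr (γ (j (u.1, max u.2 0))) - w0, Nm (γ (j (u.1, max u.2 0))) + min u.2 0 - ρ)
    have hGc : Continuous G := by fun_prop
    obtain ⟨⟨w, s⟩, hu⟩ := exists_zero G hGc (w0, ρ) τ (by
      rintro ⟨w, s⟩ hu
      have hz : a (j (w, max s 0)) ≤ 0 := by
        by_cases hs : 0 ≤ s
        · rw [max_eq_left hs]; exact hτ w s hs hu
        · push Not at hs
          rw [max_eq_right hs.le]; exact h0 w
      have hfix : γ (j (w, max s 0)) = j (w, max s 0) := hiterfix k _ hz
      simp only [G, hfix, hPr, hNm w _ (le_max_right s 0)]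
      simp [max_add_min])
    have hu1 : Pr (γ (j (w, max s 0))) - w0 = 0 := congrArg Prod.fst hu
    have hu2 : Nm (γ (j (w, max s 0))) + min s 0 - ρ = 0 := congrArg Prod.snd hu
    by_cases hs : 0 ≤ s
    · rw [max_eq_left hs] at hu1 hu2
      rw [min_eq_right hs] at hu2
      exact ⟨w, s, hs, hΓ _ (sub_eq_zero.mp hu1) (by linarith)⟩
    · push Not at hs
      rw [max_eq_right hs.le] at hu2
      rw [show γ (j (w, 0)) = j (w, 0) from hiterfix k _ (h0 w), hNm w 0 le_rfl, min_eq_left hs.le] at hu2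
      linarith
  obtain ⟨β, hβ⟩ := (isCompact_closedBall (0 : W × ℝ) τ).exists_bound_of_continuousOn (ha.comp hj).continuousOn
  obtain ⟨k, hk⟩ := exists_nat_gt ((max β 0) / (σ / 2 * ε ^ 2))
  obtain ⟨w, s, hs, hws⟩ := hintg k
  have h1 := hiter k _ hws
  have hpos : 0 < σ / 2 * ε ^ 2 := by positivity
  rw [div_lt_iff₀ hpos] at hk
  have h2 : a (j (w, s)) ≤ max β 0 := by
    by_cases h3 : τ ≤ ‖(w, s)‖
    · exact (hτ w s hs h3).trans (le_max_right _ _)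
    · push Not at h3
      have := hβ (w, s) (by simpa using h3.le)
      exact (le_abs_self _).trans (this.trans (le_max_left _ _))
  linarith

end GNS

namespace GNS

/-- The target vector space `ℂⁿ`. -/
abbrev V (n : ℕ) := EuclideanSpace ℂ (Fin n)

/-- The space of Fourier coefficients. -/
abbrev EE (n : ℕ) (ι : Type) [Fintype ι] := PiLp 2 (fun _ : ι => V n)

/-- The character `t ↦ exp (2 π i k t)`. -/
noncomputable def ex (k : ℤ) (t : ℝ) : ℂ := Complex.exp ((2 * π * k * t : ℝ) * Complex.I)

lemma norm_ex (k : ℤ) (t : ℝ) : ‖ex k t‖ = 1 := Complex.norm_exp_ofReal_mul_I _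

lemma continuous_ex (k : ℤ) : Continuous (ex k) := by unfold ex; fun_prop

lemma ex_add (k l : ℤ) (t : ℝ) : ex (k + l) t = ex k t * ex l t := by
  unfold ex; rw [← Complex.exp_add]; congr 1; push_cast; ring

lemma ex_zero (t : ℝ) : ex 0 t = 1 := by simp [ex]

lemma conj_ex (k : ℤ) (t : ℝ) : (starRingEnd ℂ) (ex k t) = ex (-k) t := by
  unfold ex; rw [← Complex.exp_conj]; congr 1; rw [map_mul, Complex.conj_ofReal, Complex.conj_I]; push_cast; ring

lemma ex_at_zero (k : ℤ) : ex k 0 = 1 := by simp [ex]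

lemma ex_at_one (k : ℤ) : ex k 1 = 1 := by
  unfold ex
  rw [Complex.exp_eq_one_iff]
  exact ⟨k, by push_cast; ring⟩

lemma hasDerivAt_ex (k : ℤ) (t : ℝ) : HasDerivAt (ex k) ((2 * π * k * Complex.I) * ex k t) t := by
  unfold ex
  have h1 : HasDerivAt (fun t : ℝ => ((2 * π * k * t : ℝ) : ℂ) * Complex.I) ((2 * π * k) * Complex.I) t := by
    have := ((hasDerivAt_id t).const_mul (2 * π * k)).ofReal_comp.mul_const Complex.I
    simpa using this
  have := h1.cexp
  convert this using 1
  ring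

lemma integral_ex (k : ℤ) : ∫ t in (0:ℝ)..1, ex k t = if k = 0 then 1 else 0 := by
  by_cases hk : k = 0
  · subst hk; simp [ex_zero]
  · rw [if_neg hk]
    have hne : (2 * π * k * Complex.I : ℂ) ≠ 0 := by
      have : (k:ℂ) ≠ 0 := by exact_mod_cast hk
      simp [this, Real.pi_ne_zero]
    have h1 : ∀ t, HasDerivAt (fun t => (2 * π * k * Complex.I)⁻¹ * ex k t) (ex k t) t := by
      intro t
      have := (hasDerivAt_ex k t).const_mul (2 * π * k * Complex.I : ℂ)⁻¹
      rwa [inv_mul_cancel_left₀ hne] at this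
    rw [intervalIntegral.integral_eq_sub_of_hasDerivAt (fun t _ => h1 t)
      ((continuous_ex k).intervalIntegrable _ _), ex_at_one, ex_at_zero, sub_self]

lemma inner_smul_conj {n : ℕ} (z : ℂ) (v w : V n) :
    inner ℝ (z • v) w = inner ℝ v ((starRingEnd ℂ) z • w) := by
  simp only [PiLp.inner_apply, Complex.inner, PiLp.smul_apply, smul_eq_mul, map_mul]
  refine Finset.sum_congr rfl fun i _ => ?_
  simp; ring

lemma inner_ex {n : ℕ} (k : ℤ) (t : ℝ) (v w : V n) :
    inner ℝ v (ex k t • w) = inner ℝ (ex (-k) t • v) w := by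
  rw [inner_smul_conj, conj_ex, neg_neg]

section
variable {n : ℕ} {ι : Type} [Fintype ι] (κ : ι → ℤ)

/-- The trigonometric polynomial with given coefficients. -/
noncomputable def xx (c : EE n ι) (t : ℝ) : V n := ∑ i, ex (κ i) t • c i

lemma continuous_xx' : Continuous (fun q : EE n ι × ℝ => xx κ q.1 q.2) := by
  unfold xx
  refine continuous_finsetSum _ fun i _ => ?_
  have h1 := continuous_ex (κ i)
  have h2 : Continuous (fun q : EE n ι × ℝ => q.1 i) := by fun_prop
  fun_prop

lemma continuous_xx (c : EE n ι) : Continuous (xx κ c) := by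
  unfold xx
  exact continuous_finsetSum _ fun i _ => (continuous_ex (κ i)).smul continuous_const

lemma xx_add (c d : EE n ι) (t : ℝ) : xx κ (c + d) t = xx κ c t + xx κ d t := by
  simp [xx, smul_add, Finset.sum_add_distrib]

lemma integral_inner_xx (F : ℝ → V n) (hF : Continuous F) (d : EE n ι) :
    ∫ t in (0:ℝ)..1, inner ℝ (F t) (xx κ d t)
      = ∑ i, inner ℝ (∫ t in (0:ℝ)..1, ex (-κ i) t • F t) (d i) := by
  have h0 : ∀ i, Continuous (fun t => ex (-κ i) t • F t) := fun i => (continuous_ex _).smul hF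
  have h1 : ∀ t, inner ℝ (F t) (xx κ d t) = ∑ i, inner ℝ (ex (-κ i) t • F t) (d i) := by
    intro t
    unfold xx
    rw [inner_sum]
    exact Finset.sum_congr rfl fun i _ => inner_ex _ _ _ _
  simp_rw [h1]
  rw [intervalIntegral.integral_finsetSum]
  · refine Finset.sum_congr rfl fun i _ => ?_
    have := (innerSL ℝ (d i)).intervalIntegral_comp_comm (μ := volume) ((h0 i).intervalIntegrable 0 1)
    simp only [innerSL_apply_apply] at this
    rw [real_inner_comm, ← this]
    simp_rw [real_inner_comm]
  · intro i _
    exact ((h0 i).inner continuous_const).intervalIntegrable _ _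

lemma coeff_xx (hκ : Function.Injective κ) (c : EE n ι) (i : ι) :
    ∫ t in (0:ℝ)..1, ex (-κ i) t • xx κ c t = c i := by
  classical
  have h1 : ∀ t, ex (-κ i) t • xx κ c t = ∑ l, ex (κ l - κ i) t • c l := by
    intro t
    unfold xx
    rw [Finset.smul_sum]
    refine Finset.sum_congr rfl fun l _ => ?_
    rw [smul_smul, ← ex_add]; congr 2; ring
  simp_rw [h1]
  rw [intervalIntegral.integral_finsetSum]
  · simp_rw [intervalIntegral.integral_smul_const, integral_ex, sub_eq_zero]
    rw [Finset.sum_eq_single i]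
    · simp
    · intro l _ hl
      rw [if_neg (fun h => hl (hκ h)), zero_smul]
    · simp
  · intro l _
    exact ((continuous_ex _).smul continuous_const).intervalIntegrable _ _

lemma parseval_inner (hκ : Function.Injective κ) (c d : EE n ι) :
    ∫ t in (0:ℝ)..1, inner ℝ (xx κ c t) (xx κ d t) = ∑ i, inner ℝ (c i) (d i) := by
  rw [integral_inner_xx κ _ (continuous_xx κ c)]
  simp_rw [coeff_xx κ hκ]

lemma parseval (hκ : Function.Injective κ) (c : EE n ι) :
    ∫ t in (0:ℝ)..1, ‖xx κ c t‖ ^ 2 = ‖c‖ ^ 2 := by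
  have := parseval_inner κ hκ c c
  simp_rw [real_inner_self_eq_norm_sq] at this
  rw [this, PiLp.norm_sq_eq_of_L2]

end

end GNS

namespace GNS

/-- Diagonal operator `z ↦ (2 π a_k z_k)_k`. -/
noncomputable def Am {n : ℕ} (av : Fin n → ℝ) (z : V n) : V n :=
  WithLp.toLp 2 (fun k => ((2 * π * av k : ℝ) : ℂ) * z k)

lemma Am_apply {n : ℕ} (av : Fin n → ℝ) (z : V n) (k : Fin n) :
    Am av z k = ((2 * π * av k : ℝ) : ℂ) * z k := rfl

lemma continuous_Am {n : ℕ} (av : Fin n → ℝ) : Continuous (Am av) := by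
  unfold Am
  fun_prop

lemma Am_smul {n : ℕ} (av : Fin n → ℝ) (c : ℂ) (z : V n) : Am av (c • z) = c • Am av z := by
  ext k; simp [Am_apply]; ring

lemma Am_sum {n : ℕ} {ι : Type} [Fintype ι] (av : Fin n → ℝ) (z : ι → V n) :
    Am av (∑ i, z i) = ∑ i, Am av (z i) := by
  ext k; simp [Am_apply, Finset.mul_sum]

lemma inner_Am {n : ℕ} (av : Fin n → ℝ) (z : V n) :
    inner ℝ (Am av z) z = ∑ k, 2 * π * av k * ‖z k‖ ^ 2 := by
  simp only [PiLp.inner_apply, Complex.inner, Am_apply, ← Complex.normSq_eq_norm_sq, Complex.normSq_apply]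
  refine Finset.sum_congr rfl fun i _ => ?_
  simp; ring

/-- Hypotheses on the Hamiltonian function. -/
structure GoodHam {n : ℕ} (i0 : Fin n) (H : V n → ℝ) (G : V n → V n) (av : Fin n → ℝ) (p : V n)
    (L C m : ℝ) : Prop where
  Cpos : 0 < C
  Lpos : 0 < L
  mpos : 0 < m
  cont : Continuous H
  lip : ∀ z w, ‖G z - G w‖ ≤ L * ‖z - w‖
  quad : ∀ z v, H z + inner ℝ (G z) v - L * ‖v‖ ^ 2 ≤ H (z + v)
  nonneg : ∀ z, 0 ≤ H z
  quartic : ∀ z, H z ≤ C * ‖z - p‖ ^ 4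
  lower : ∀ z, (1/2) * inner ℝ (Am av z) z - C ≤ H z
  asym : ∀ z, ‖G z - Am av z‖ ≤ C
  av1 : ∀ k, m ≤ av k
  av2 : 1 + m ≤ av i0
  av3 : av i0 ≤ 2 - m
  av4 : ∀ k, k ≠ i0 → av k ≤ 1 - m

lemma GoodHam.contG {n : ℕ} {i0 : Fin n} {H : V n → ℝ} {G : V n → V n} {av : Fin n → ℝ} {p : V n}
    {L C m : ℝ} (h : GoodHam i0 H G av p L C m) : Continuous G := by
  have : LipschitzWith (Real.toNNReal L) G := by
    refine LipschitzWith.of_dist_le_mul fun z w => ?_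
    rw [Real.coe_toNNReal _ h.Lpos.le, dist_eq_norm, dist_eq_norm]
    exact h.lip z w
  exact this.continuous

section
variable {n : ℕ} {ι : Type} [Fintype ι] (κ : ι → ℤ)

/-- The action functional on coefficients. -/
noncomputable def act (H : V n → ℝ) (c : EE n ι) : ℝ :=
  π * ∑ i, (κ i : ℝ) * ‖c i‖ ^ 2 - ∫ t in (0:ℝ)..1, H (xx κ c t)

/-- The gradient of the action functional. -/
noncomputable def gr (G : V n → V n) (c : EE n ι) : EE n ι :=
  WithLp.toLp 2 (fun i => (2 * π * κ i : ℝ) • c i - ∫ t in (0:ℝ)..1, ex (-κ i) t • G (xx κ c t))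

lemma inner_gr (G : V n → V n) (hG : Continuous G) (c d : EE n ι) :
    inner ℝ (gr κ G c) d = ∑ i, (2 * π * κ i) * inner ℝ (c i) (d i)
      - ∫ t in (0:ℝ)..1, inner ℝ (G (xx κ c t)) (xx κ d t) := by
  rw [integral_inner_xx κ (fun t => G (xx κ c t)) (hG.comp (continuous_xx κ c)), PiLp.inner_apply, ← Finset.sum_sub_distrib]
  refine Finset.sum_congr rfl fun i _ => ?_
  simp only [gr]
  rw [inner_sub_left, real_inner_smul_left]

lemma continuous_act (H : V n → ℝ) (hH : Continuous H) : Continuous (act κ H : EE n ι → ℝ) := by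
  unfold act
  refine Continuous.sub ?_ ?_
  · fun_prop
  · apply intervalIntegral.continuous_parametric_intervalIntegral_of_continuous'
    exact hH.comp (continuous_xx' κ)

lemma continuous_gr (G : V n → V n) (hG : Continuous G) : Continuous (gr κ G : EE n ι → EE n ι) := by
  unfold gr
  refine (PiLp.continuous_toLp 2 _).comp ?_
  refine continuous_pi fun i => ?_
  refine Continuous.sub ?_ ?_
  · fun_prop
  · apply intervalIntegral.continuous_parametric_intervalIntegral_of_continuous'
    have h1 : Continuous (fun q : EE n ι × ℝ => ex (-κ i) q.2) := (continuous_ex _).comp continuous_snd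
    exact h1.smul (hG.comp (continuous_xx' κ))

lemma act_quad {i0 : Fin n} {H : V n → ℝ} {G : V n → V n} {av : Fin n → ℝ} {p : V n}
    {L C m : ℝ} (h : GoodHam i0 H G av p L C m) (hκ : Function.Injective κ) (c d : EE n ι) :
    act κ H (c + d) ≤ act κ H c + inner ℝ (gr κ G c) d + (π * ∑ i, |(κ i : ℝ)| + L) * ‖d‖ ^ 2 := by
  rw [inner_gr κ G h.contG]
  unfold act
  have hx := continuous_xx κ c
  have hd := continuous_xx κ d
  have hcd := continuous_xx κ (c + d)
  have hH := h.cont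
  have hGc := h.contG
  have i1 : ∫ t in (0:ℝ)..1, (H (xx κ c t) + inner ℝ (G (xx κ c t)) (xx κ d t) - L * ‖xx κ d t‖ ^ 2)
      ≤ ∫ t in (0:ℝ)..1, H (xx κ (c + d) t) := by
    apply intervalIntegral.integral_mono_on zero_le_one
    · apply Continuous.intervalIntegrable
      exact ((hH.comp hx).add ((hGc.comp hx).inner hd)).sub (continuous_const.mul (hd.norm.pow 2))
    · exact (hH.comp hcd).intervalIntegrable _ _
    · intro t _
      rw [xx_add]
      exact h.quad _ _
  rw [intervalIntegral.integral_sub, intervalIntegral.integral_add, intervalIntegral.integral_const_mul,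
    parseval κ hκ] at i1
  rotate_left
  · exact (hH.comp hx).intervalIntegrable _ _
  · exact ((hGc.comp hx).inner hd).intervalIntegrable _ _
  · exact ((hH.comp hx).add ((hGc.comp hx).inner hd)).intervalIntegrable _ _
  · exact (continuous_const.mul (hd.norm.pow 2)).intervalIntegrable _ _
  have i2 : ∑ i, (κ i : ℝ) * ‖(c + d) i‖ ^ 2 = ∑ i, (κ i : ℝ) * ‖c i‖ ^ 2
      + ∑ i, 2 * (κ i : ℝ) * inner ℝ (c i) (d i) + ∑ i, (κ i : ℝ) * ‖d i‖ ^ 2 := by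
    rw [← Finset.sum_add_distrib, ← Finset.sum_add_distrib]
    refine Finset.sum_congr rfl fun i _ => ?_
    rw [PiLp.add_apply, norm_add_sq_real]; ring
  have i3 : ∑ i, (κ i : ℝ) * ‖d i‖ ^ 2 ≤ (∑ i, |(κ i : ℝ)|) * ‖d‖ ^ 2 := by
    rw [Finset.sum_mul]
    refine Finset.sum_le_sum fun i _ => ?_
    have h1 : ‖d i‖ ^ 2 ≤ ‖d‖ ^ 2 := by
      have := PiLp.norm_apply_le d i
      gcongr
    have h2 := le_abs_self (κ i : ℝ)
    have h3 := abs_nonneg (κ i : ℝ)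
    nlinarith [sq_nonneg ‖d i‖]
  have i4 : ∑ i, (2 * π * κ i) * inner ℝ (c i) (d i) = π * ∑ i, 2 * (κ i : ℝ) * inner ℝ (c i) (d i) := by
    rw [Finset.mul_sum]
    exact Finset.sum_congr rfl fun i _ => by ring
  rw [i2, i4]
  have := mul_le_mul_of_nonneg_left i3 Real.pi_pos.le
  nlinarith

lemma integral_inner_Am (hκ : Function.Injective κ) (av : Fin n → ℝ) (c : EE n ι) :
    ∫ t in (0:ℝ)..1, inner ℝ (Am av (xx κ c t)) (xx κ c t) = ∑ i, inner ℝ (Am av (c i)) (c i) := by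
  have : ∀ t, Am av (xx κ c t) = xx κ (WithLp.toLp 2 (fun i => Am av (c i)) : EE n ι) t := by
    intro t
    unfold xx
    rw [Am_sum]
    exact Finset.sum_congr rfl fun i _ => Am_smul _ _ _
  simp_rw [this]
  rw [parseval_inner κ hκ]

end

end GNS

namespace GNS

/-- Scalar Parseval for polynomials evaluated on the circle. -/
lemma parseval_poly (P : Polynomial ℂ) (M : ℕ) (hM : P.natDegree < M) :
    ∫ t in (0:ℝ)..1, ‖P.eval (ex 1 t)‖ ^ 2 = ∑ i ∈ Finset.range M, ‖P.coeff i‖ ^ 2 := by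
  have hκ : Function.Injective (fun i : Fin M => ((i : ℕ) : ℤ)) := by
    intro a b h
    simpa [Fin.ext_iff] using h
  have hpow : ∀ (k : ℕ) t, ex (k : ℤ) t = ex 1 t ^ k := by
    intro k t
    induction k with
    | zero => simp [ex_zero]
    | succ k ih => rw [pow_succ, ← ih, ← ex_add]; push_cast; rfl
  set c : EE 1 (Fin M) := WithLp.toLp 2 (fun i => EuclideanSpace.single 0 (P.coeff i)) with hc
  have := parseval _ hκ c
  rw [PiLp.norm_sq_eq_of_L2] at this
  have e1 : ∀ t, ‖xx (fun i : Fin M => ((i : ℕ) : ℤ)) c t‖ = ‖P.eval (ex 1 t)‖ := by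
    intro t
    have : xx (fun i : Fin M => ((i : ℕ) : ℤ)) c t = EuclideanSpace.single 0 (P.eval (ex 1 t)) := by
      ext k
      fin_cases k
      rw [Polynomial.eval_eq_sum_range' hM, ← Fin.sum_univ_eq_sum_range (fun i => P.coeff i * ex 1 t ^ i)]
      simp [xx, hc, hpow, mul_comm]
    rw [this]; simp
  simp_rw [e1] at this
  rw [this, ← Fin.sum_univ_eq_sum_range (fun i => ‖P.coeff i‖ ^ 2)]
  simp [hc]

lemma quartic_poly (P : Polynomial ℂ) (h0 : P.coeff 0 = 0) (N : ℕ) (hN : P.natDegree < N) :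
    ∫ t in (0:ℝ)..1, ‖P.eval (ex 1 t)‖ ^ 4 ≤ 3 * (∑ i ∈ Finset.range N, (i : ℝ) * ‖P.coeff i‖ ^ 2) ^ 2 := by
  have e1 : ∀ t, ‖P.eval (ex 1 t)‖ ^ 4 = ‖(P * P).eval (ex 1 t)‖ ^ 2 := by
    intro t; rw [Polynomial.eval_mul, norm_mul]; ring
  simp_rw [e1]
  rw [parseval_poly (P * P) (2 * N) (by
    have := Polynomial.natDegree_mul_le (p := P) (q := P)
    omega)]
  set b : ℕ → ℝ := fun i => (i : ℝ) * ‖P.coeff i‖ ^ 2 with hb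
  have hb0 : ∀ i, 0 ≤ b i := fun i => by positivity
  have hbN : ∀ i, N ≤ i → b i = 0 := by
    intro i hi
    simp [hb, Polynomial.coeff_eq_zero_of_natDegree_lt (lt_of_lt_of_le hN hi)]
  have key : ∀ m, ‖(P * P).coeff m‖ ^ 2 ≤ 3 * ∑ q ∈ Finset.HasAntidiagonal.antidiagonal m, b q.1 * b q.2 := by
    intro m
    rw [Polynomial.coeff_mul]
    have s1 : ‖∑ q ∈ Finset.HasAntidiagonal.antidiagonal m, P.coeff q.1 * P.coeff q.2‖ ^ 2
        ≤ (∑ q ∈ Finset.HasAntidiagonal.antidiagonal m, ‖P.coeff q.1‖ * ‖P.coeff q.2‖) ^ 2 := by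
      gcongr
      refine (norm_sum_le _ _).trans (le_of_eq ?_)
      simp
    refine s1.trans ((sq_sum_le_card_mul_sum_sq).trans ?_)
    rw [Finset.Nat.card_antidiagonal, Finset.mul_sum, Finset.mul_sum]
    refine Finset.sum_le_sum fun q hq => ?_
    rw [Finset.HasAntidiagonal.mem_antidiagonal] at hq
    rcases Nat.eq_zero_or_pos q.1 with h | h
    · simp [h, h0, hb]
    rcases Nat.eq_zero_or_pos q.2 with h' | h'
    · simp [h', h0, hb]
    have h1 : (1:ℝ) ≤ q.1 := by exact_mod_cast h
    have h2 : (1:ℝ) ≤ q.2 := by exact_mod_cast h'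
    have h3 : ((m + 1 : ℕ) : ℝ) ≤ 3 * (q.1 * q.2) := by
      rw [← hq]; push_cast; nlinarith
    calc ((m + 1 : ℕ) : ℝ) * (‖P.coeff q.1‖ * ‖P.coeff q.2‖) ^ 2
        ≤ (3 * (q.1 * q.2)) * (‖P.coeff q.1‖ * ‖P.coeff q.2‖) ^ 2 := by gcongr
      _ = _ := by simp only [hb]; ring
  refine (Finset.sum_le_sum fun m _ => key m).trans ?_
  rw [← Finset.mul_sum]
  refine mul_le_mul_of_nonneg_left ?_ (by norm_num)
  -- product of sums
  have : (∑ i ∈ Finset.range N, b i) ^ 2 = ∑ q ∈ Finset.range N ×ˢ Finset.range N, b q.1 * b q.2 := by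
    rw [sq, Finset.sum_mul_sum, Finset.sum_product]
  rw [this]
  have e2 : ∑ m ∈ Finset.range (2 * N), ∑ q ∈ Finset.HasAntidiagonal.antidiagonal m, b q.1 * b q.2
      = ∑ q ∈ (Finset.range (2 * N)).sigma (fun m => Finset.HasAntidiagonal.antidiagonal m), b q.2.1 * b q.2.2 := by
    rw [Finset.sum_sigma]
  rw [e2]
  classical
  have e3 : ∑ q ∈ (Finset.range (2 * N)).sigma (fun m => Finset.HasAntidiagonal.antidiagonal m), b q.2.1 * b q.2.2
     = ∑ q ∈ ((Finset.range (2 * N)).sigma (fun m => Finset.HasAntidiagonal.antidiagonal m)).image (fun q => q.2), b q.1 * b q.2 := by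
    rw [Finset.sum_image]
    rintro ⟨m, q⟩ hm ⟨m', q'⟩ hm' h
    simp only [Finset.coe_sigma, Set.mem_sigma_iff, Finset.mem_coe, Finset.HasAntidiagonal.mem_antidiagonal] at hm hm' h
    obtain ⟨_, rfl⟩ := hm
    obtain ⟨_, rfl⟩ := hm'
    subst h
    rfl
  rw [e3]
  refine le_of_eq_of_le (Finset.sum_subset_zero_on_sdiff (s₁ := Finset.range N ×ˢ Finset.range N) (g := fun q => b q.1 * b q.2) (f := fun q => b q.1 * b q.2) ?_ ?_ ?_).symm le_rfl
  · rintro ⟨i, j⟩ h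
    simp only [Finset.mem_product, Finset.mem_range] at h
    simp only [Finset.mem_image, Finset.mem_sigma, Finset.mem_range, Finset.HasAntidiagonal.mem_antidiagonal]
    exact ⟨⟨i + j, (i, j)⟩, ⟨(by omega : i + j < 2 * N), rfl⟩, rfl⟩
  · rintro ⟨i, j⟩ h
    simp only [Finset.mem_sdiff, Finset.mem_product, Finset.mem_range, not_and_or, not_lt] at h
    rcases h.2 with h | h
    · simp [hbN i h]
    · simp [hbN j h]
  · intros; rfl

lemma quartic_scalar (N : ℕ) (c : Fin N → ℂ) :
    ∫ t in (0:ℝ)..1, ‖∑ i : Fin N, ex ((i : ℕ) + 1) t * c i‖ ^ 4 ≤ 3 * (∑ i : Fin N, ((i : ℕ) + 1 : ℝ) * ‖c i‖ ^ 2) ^ 2 := by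
  set P : Polynomial ℂ := ∑ i : Fin N, Polynomial.monomial ((i : ℕ) + 1) (c i) with hP
  have hpow : ∀ (k : ℕ) t, ex (k : ℤ) t = ex 1 t ^ k := by
    intro k t
    induction k with
    | zero => simp [ex_zero]
    | succ k ih => rw [pow_succ, ← ih, ← ex_add]; push_cast; rfl
  have hc1 : ∀ i : Fin N, P.coeff ((i : ℕ) + 1) = c i := by
    intro i
    simp only [hP, Polynomial.finsetSum_coeff, Polynomial.coeff_monomial]
    rw [Finset.sum_eq_single i]
    · simp
    · intro b _ hb
      rw [if_neg]
      intro h; apply hb; ext; omega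
    · simp
  have h0 : P.coeff 0 = 0 := by
    simp [hP, Polynomial.finsetSum_coeff, Polynomial.coeff_monomial]
  have hdeg : P.natDegree < N + 1 := by
    rw [Nat.lt_succ_iff]
    refine Polynomial.natDegree_sum_le_of_forall_le _ _ fun i _ => ?_
    refine (Polynomial.natDegree_monomial_le _).trans ?_
    omega
  have := quartic_poly P h0 (N + 1) hdeg
  have e : ∀ t, P.eval (ex 1 t) = ∑ i : Fin N, ex ((i : ℕ) + 1) t * c i := by
    intro t
    simp only [hP, Polynomial.eval_finsetSum, Polynomial.eval_monomial]
    refine Finset.sum_congr rfl fun i _ => ?_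
    rw [← hpow]; push_cast; ring
  simp_rw [e] at this
  rw [Finset.sum_range_succ'] at this
  simp only [h0] at this
  refine this.trans (le_of_eq ?_)
  rw [← Fin.sum_univ_eq_sum_range (fun i => ((i + 1 : ℕ) : ℝ) * ‖P.coeff (i + 1)‖ ^ 2)]
  simp_rw [hc1]
  simp

lemma quartic_vec {n N : ℕ} (c : Fin N → V n) :
    ∫ t in (0:ℝ)..1, ‖∑ i : Fin N, ex ((i : ℕ) + 1) t • c i‖ ^ 4
      ≤ 3 * n * (∑ i : Fin N, ((i : ℕ) + 1 : ℝ) * ‖c i‖ ^ 2) ^ 2 := by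
  have h1 : ∀ t, ‖∑ i : Fin N, ex ((i : ℕ) + 1) t • c i‖ ^ 4
      ≤ n * ∑ k, ‖∑ i : Fin N, ex ((i : ℕ) + 1) t * c i k‖ ^ 4 := by
    intro t
    set v := ∑ i : Fin N, ex ((i : ℕ) + 1) t • c i with hv
    have hk : ∀ k, ∑ i : Fin N, ex ((i : ℕ) + 1) t * c i k = v k := by
      intro k; simp [hv]
    simp_rw [hk]
    have e : ‖v‖ ^ 4 = (∑ k, ‖v k‖ ^ 2) ^ 2 := by
      rw [← EuclideanSpace.norm_sq_eq]; ring
    rw [e]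
    refine (sq_sum_le_card_mul_sum_sq).trans (le_of_eq ?_)
    simp [← pow_mul]
  have hcont : ∀ k, Continuous (fun t => ‖∑ i : Fin N, ex ((i : ℕ) + 1) t * c i k‖ ^ 4) := fun k =>
    (continuous_finsetSum _ fun i _ => (continuous_ex _).mul continuous_const).norm.pow 4
  have h2 : ∫ t in (0:ℝ)..1, ‖∑ i : Fin N, ex ((i : ℕ) + 1) t • c i‖ ^ 4
      ≤ ∫ t in (0:ℝ)..1, n * ∑ k, ‖∑ i : Fin N, ex ((i : ℕ) + 1) t * c i k‖ ^ 4 := by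
    apply intervalIntegral.integral_mono_on zero_le_one
    · exact ((continuous_finsetSum _ fun i _ => (continuous_ex _).smul continuous_const).norm.pow 4).intervalIntegrable _ _
    · exact (continuous_const.mul (continuous_finsetSum _ fun k _ => hcont k)).intervalIntegrable _ _
    · intro t _; exact h1 t
  refine h2.trans ?_
  rw [intervalIntegral.integral_const_mul, intervalIntegral.integral_finsetSum
    (fun k _ => (hcont k).intervalIntegrable _ _)]
  have h3 : ∑ k, ∫ t in (0:ℝ)..1, ‖∑ i : Fin N, ex ((i : ℕ) + 1) t * c i k‖ ^ 4
      ≤ ∑ k, 3 * (∑ i : Fin N, ((i : ℕ) + 1 : ℝ) * ‖c i k‖ ^ 2) ^ 2 :=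
    Finset.sum_le_sum fun k _ => quartic_scalar N (fun i => c i k)
  have h4 : ∑ k, 3 * (∑ i : Fin N, ((i : ℕ) + 1 : ℝ) * ‖c i k‖ ^ 2) ^ 2
      ≤ 3 * (∑ i : Fin N, ((i : ℕ) + 1 : ℝ) * ‖c i‖ ^ 2) ^ 2 := by
    rw [← Finset.mul_sum]
    refine mul_le_mul_of_nonneg_left ?_ (by norm_num)
    have e : ∑ i : Fin N, ((i : ℕ) + 1 : ℝ) * ‖c i‖ ^ 2
        = ∑ k, ∑ i : Fin N, ((i : ℕ) + 1 : ℝ) * ‖c i k‖ ^ 2 := by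
      rw [Finset.sum_comm]
      refine Finset.sum_congr rfl fun i _ => ?_
      rw [EuclideanSpace.norm_sq_eq, Finset.mul_sum]
    rw [e]
    exact Finset.sum_sq_le_sq_sum_of_nonneg fun k _ => Finset.sum_nonneg fun i _ => by positivity
  have := mul_le_mul_of_nonneg_left (h3.trans h4) (Nat.cast_nonneg (α := ℝ) n)
  linarith

end GNS

namespace GNS

/-- Frequencies of the Galerkin approximation. -/
def kk (N : ℕ) : Fin (N+1) ⊕ Fin (N+1) → ℤ :=
  Sum.elim (fun i => -((i : ℕ) : ℤ)) (fun i => ((i : ℕ) : ℤ) + 1)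

lemma kk_inj (N : ℕ) : Function.Injective (kk N) := by
  rintro (i | i) (j | j) h <;> simp only [kk, Sum.elim_inl, Sum.elim_inr] at h
  · congr 1; ext; omega
  · omega
  · omega
  · congr 1; ext; omega

lemma kk_surj (N : ℕ) (k : ℤ) (hk : |k| ≤ N) : ∃ i, kk N i = k := by
  rcases le_or_gt k 0 with h | h
  · rw [abs_of_nonpos h] at hk
    exact ⟨Sum.inl ⟨k.natAbs, by omega⟩, by simp only [kk, Sum.elim_inl]; omega⟩
  · rw [abs_of_pos h] at hk
    exact ⟨Sum.inr ⟨k.natAbs - 1, by omega⟩, by simp [kk]; omega⟩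

section
variable {n : ℕ} {i0 : Fin n} {H : V n → ℝ} {G : V n → V n} {av : Fin n → ℝ} {p : V n} {L C m : ℝ}

/-- Linking map. -/
noncomputable def jj (i0 : Fin n) (N : ℕ) (q : (Fin (N+1) → V n) × ℝ) : EE n (Fin (N+1) ⊕ Fin (N+1)) :=
  WithLp.toLp 2 (Sum.elim q.1 (fun i => if i = 0 then EuclideanSpace.single i0 (q.2 : ℂ) else 0))

lemma continuous_jj (i0 : Fin n) (N : ℕ) : Continuous (jj i0 N) := by
  unfold jj
  refine (PiLp.continuous_toLp 2 _).comp (continuous_pi ?_)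
  rintro (i | i)
  · simp only [Sum.elim_inl]; fun_prop
  · simp only [Sum.elim_inr]
    split_ifs
    · have : (fun a : (Fin (N+1) → V n) × ℝ => EuclideanSpace.single i0 (a.2 : ℂ)) = fun a => WithLp.toLp 2 (Pi.single i0 (a.2 : ℂ)) := rfl
      rw [this]
      refine (PiLp.continuous_toLp 2 _).comp ?_
      exact (continuous_single i0).comp (Complex.continuous_ofReal.comp continuous_snd)
    · exact continuous_const

lemma inner_Am_lower (h : GoodHam i0 H G av p L C m) (z : V n) :
    2 * π * m * ‖z‖ ^ 2 ≤ inner ℝ (Am av z) z := by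
  rw [inner_Am, EuclideanSpace.norm_sq_eq, Finset.mul_sum]
  refine Finset.sum_le_sum fun k _ => ?_
  have := h.av1 k
  have := Real.pi_pos
  gcongr

lemma int_H_nonneg (h : GoodHam i0 H G av p L C m) {ι : Type} [Fintype ι] (κ : ι → ℤ) (c : EE n ι) :
    0 ≤ ∫ t in (0:ℝ)..1, H (xx κ c t) :=
  intervalIntegral.integral_nonneg zero_le_one fun _ _ => h.nonneg _

lemma int_H_lower (h : GoodHam i0 H G av p L C m) {ι : Type} [Fintype ι] (κ : ι → ℤ)
    (hκ : Function.Injective κ) (c : EE n ι) :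
    (1/2) * ∑ i, inner ℝ (Am av (c i)) (c i) - C ≤ ∫ t in (0:ℝ)..1, H (xx κ c t) := by
  have hx := continuous_xx κ c
  have hA := (continuous_Am av).comp hx
  have hi := hA.inner (𝕜 := ℝ) hx
  have i1 : ∫ t in (0:ℝ)..1, ((1/2) * inner ℝ (Am av (xx κ c t)) (xx κ c t) - C)
      ≤ ∫ t in (0:ℝ)..1, H (xx κ c t) := by
    apply intervalIntegral.integral_mono_on zero_le_one
    · exact ((continuous_const.mul hi).sub continuous_const).intervalIntegrable _ _
    · exact (h.cont.comp hx).intervalIntegrable _ _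
    · intro t _; exact h.lower _
  rw [intervalIntegral.integral_sub, intervalIntegral.integral_const_mul, integral_inner_Am κ hκ] at i1
  rotate_left
  · exact (continuous_const.mul hi).intervalIntegrable _ _
  · exact continuous_const.intervalIntegrable _ _
  simpa using i1

lemma act_jj (N : ℕ) (w : Fin (N+1) → V n) (s : ℝ) (H : V n → ℝ) :
    act (kk N) H (jj i0 N (w, s)) = π * (s ^ 2 - ∑ i : Fin (N+1), (i : ℝ) * ‖w i‖ ^ 2)
      - ∫ t in (0:ℝ)..1, H (xx (kk N) (jj i0 N (w, s)) t) := by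
  unfold act
  congr 2
  rw [Fintype.sum_sum_type]
  have : ∑ i : Fin (N+1), (kk N (Sum.inr i) : ℝ) * ‖jj i0 N (w, s) (Sum.inr i)‖ ^ 2 = s ^ 2 := by
    rw [Finset.sum_eq_single 0]
    · simp [kk, jj]
    · intro b _ hb; simp [jj, hb]
    · simp
  rw [this]
  simp [kk, jj]
  ring

lemma quartic_int (h : GoodHam i0 H G av p L C m) (N : ℕ) (c : EE n (Fin (N+1) ⊕ Fin (N+1)))
    (hc0 : c (Sum.inl 0) = p) (hc : ∀ i, i ≠ 0 → c (Sum.inl i) = 0) :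
    ∫ t in (0:ℝ)..1, H (xx (kk N) c t)
      ≤ C * (3 * n * (∑ i : Fin (N+1), ((i : ℕ) + 1 : ℝ) * ‖c (Sum.inr i)‖ ^ 2) ^ 2) := by
  have hx := continuous_xx (kk N) c
  have hy : ∀ t, xx (kk N) c t - p = ∑ i : Fin (N+1), ex ((i : ℕ) + 1) t • c (Sum.inr i) := by
    intro t
    unfold xx
    rw [Fintype.sum_sum_type, Finset.sum_eq_single (0 : Fin (N+1))]
    · simp [kk, hc0, ex_zero]
    · intro b _ hb; rw [hc b hb, smul_zero]
    · simp
  have i1 : ∫ t in (0:ℝ)..1, H (xx (kk N) c t) ≤ ∫ t in (0:ℝ)..1, C * ‖xx (kk N) c t - p‖ ^ 4 := by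
    apply intervalIntegral.integral_mono_on zero_le_one
    · exact (h.cont.comp hx).intervalIntegrable _ _
    · exact (continuous_const.mul ((hx.sub continuous_const).norm.pow 4)).intervalIntegrable _ _
    · intro t _; exact h.quartic _
  refine i1.trans ?_
  rw [intervalIntegral.integral_const_mul]
  refine mul_le_mul_of_nonneg_left ?_ h.Cpos.le
  simp_rw [hy]
  exact quartic_vec (fun i => c (Sum.inr i))

lemma galerkin (h : GoodHam i0 H G av p L C m) : ∃ α > 0, ∀ (N : ℕ) (ε : ℝ), 0 < ε →
    ∃ c, α ≤ act (kk N) H c ∧ ‖gr (kk N) G c‖ < ε := by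
  have hpi := Real.pi_pos
  have hC := h.Cpos
  have hm := h.mpos
  have hn : (0:ℝ) < n := by exact_mod_cast (Fin.pos i0)
  set K : ℝ := 3 * n * C with hK
  have hKpos : 0 < K := by positivity
  set ρ : ℝ := √(π / (2 * K)) with hρ
  have hρpos : 0 < ρ := Real.sqrt_pos.2 (by positivity)
  have hρ2 : ρ ^ 2 = π / (2 * K) := Real.sq_sqrt (by positivity)
  refine ⟨π * ρ ^ 2 / 2, by positivity, fun N ε hε => ?_⟩
  set w0 : Fin (N+1) → V n := fun i => if i = 0 then p else 0 with hw0
  refine minimax (act (kk N) H) (gr (kk N) G) (continuous_act _ _ h.cont) (continuous_gr _ _ h.contG)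
    (π * ∑ i, |(kk N i : ℝ)| + L) ?_ (fun c d => act_quad _ h (kk_inj N) c d) (jj i0 N) (continuous_jj i0 N)
    (fun c i => c (Sum.inl i)) ?_ (fun c => √(∑ i : Fin (N+1), ((i : ℕ) + 1 : ℝ) * ‖c (Sum.inr i)‖ ^ 2)) ?_
    ?_ ?_ w0 ρ (π * ρ ^ 2 / 2) (√(C / (π * m))) hρpos (by positivity) ?_ ?_ ?_ ε hε
  · have := h.Lpos
    positivity
  · fun_prop
  · fun_prop
  · intro w s; rfl
  · intro w s hs
    rw [Finset.sum_eq_single 0]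
    · simp [jj, Real.sqrt_sq hs]
    · intro b _ hb; simp [jj, hb]
    · simp
  · intro w
    rw [act_jj]
    have := int_H_nonneg h (kk N) (jj i0 N (w, 0))
    have h2 : 0 ≤ ∑ i : Fin (N+1), (i : ℝ) * ‖w i‖ ^ 2 := Finset.sum_nonneg fun i _ => by positivity
    nlinarith
  · intro w s hs hτ
    rw [act_jj]
    have h1 := int_H_lower h (kk N) (kk_inj N) (jj i0 N (w, s))
    rw [Fintype.sum_sum_type] at h1
    have e1 : ∑ i : Fin (N+1), inner ℝ (Am av (jj i0 N (w, s) (Sum.inr i))) (jj i0 N (w, s) (Sum.inr i))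
        = 2 * π * av i0 * s ^ 2 := by
      rw [Finset.sum_eq_single 0]
      · rw [inner_Am, Finset.sum_eq_single i0]
        · simp [jj]
        · intro b _ hb; simp [jj, hb]
        · simp
      · intro b _ hb; simp [jj, hb]
      · simp
    have e2 : 2 * π * m * ∑ i, ‖w i‖ ^ 2 ≤
        ∑ i : Fin (N+1), inner ℝ (Am av (jj i0 N (w, s) (Sum.inl i))) (jj i0 N (w, s) (Sum.inl i)) := by
      rw [Finset.mul_sum]
      exact Finset.sum_le_sum fun i _ => inner_Am_lower h (w i)
    rw [e1] at h1
    have h2 : 0 ≤ ∑ i : Fin (N+1), (i : ℝ) * ‖w i‖ ^ 2 := Finset.sum_nonneg fun i _ => by positivity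
    have h3 : ‖(w, s)‖ ^ 2 ≤ ∑ i, ‖w i‖ ^ 2 + s ^ 2 := by
      have hS : 0 ≤ ∑ i, ‖w i‖ ^ 2 := Finset.sum_nonneg fun i _ => by positivity
      have : ‖(w, s)‖ ≤ √(∑ i, ‖w i‖ ^ 2 + s ^ 2) := by
        rw [Prod.norm_def]
        refine max_le ?_ ?_
        · rw [pi_norm_le_iff_of_nonneg (Real.sqrt_nonneg _)]
          intro i
          refine Real.le_sqrt_of_sq_le ?_
          have := Finset.single_le_sum (f := fun i => ‖w i‖ ^ 2) (fun i _ => by positivity) (Finset.mem_univ i)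
          nlinarith [sq_nonneg s]
        · refine Real.le_sqrt_of_sq_le ?_
          simp only [Real.norm_eq_abs, sq_abs]
          linarith
      calc ‖(w, s)‖ ^ 2 ≤ √(∑ i, ‖w i‖ ^ 2 + s ^ 2) ^ 2 := by gcongr
        _ = _ := Real.sq_sqrt (by positivity)
    have h4 : C / (π * m) ≤ ‖(w, s)‖ ^ 2 := by
      rw [← Real.sq_sqrt (show 0 ≤ C / (π * m) by positivity)]
      gcongr
    have h5 : C ≤ π * m * (∑ i, ‖w i‖ ^ 2 + s ^ 2) := by
      rw [div_le_iff₀ (by positivity)] at h4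
      nlinarith [mul_pos hpi hm]
    have h6 : π * (1 + m) * s ^ 2 ≤ π * av i0 * s ^ 2 := by
      have := h.av2
      gcongr
    have h7 := mul_nonneg hpi.le h2
    linarith
  · intro c hPr hNm
    have hsum : ∑ i : Fin (N+1), ((i : ℕ) + 1 : ℝ) * ‖c (Sum.inr i)‖ ^ 2 = ρ ^ 2 := by
      rw [← hNm, Real.sq_sqrt (Finset.sum_nonneg fun i _ => by positivity)]
    have hc0 : c (Sum.inl 0) = p := by
      have := congrFun hPr 0; simpa [hw0] using this
    have hc : ∀ i, i ≠ 0 → c (Sum.inl i) = 0 := by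
      intro i hi
      have := congrFun hPr i; simpa [hw0, hi] using this
    have h1 := quartic_int h N c hc0 hc
    rw [hsum] at h1
    unfold act
    have e1 : ∑ i, (kk N i : ℝ) * ‖c i‖ ^ 2 = ρ ^ 2 := by
      rw [← hsum, Fintype.sum_sum_type, Finset.sum_eq_single (0 : Fin (N+1))]
      · simp [kk]
      · intro b _ hb; simp [hc b hb]
      · simp
    rw [e1]
    have e2 : C * (3 * n * (ρ ^ 2) ^ 2) = π * ρ ^ 2 / 2 := by
      have : C * (3 * n * (ρ ^ 2) ^ 2) = K * ρ ^ 2 * ρ ^ 2 := by rw [hK]; ring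
      rw [this]
      have : K * ρ ^ 2 = π / 2 := by rw [hρ2]; field_simp
      rw [this]; ring
    rw [e2] at h1
    linarith

end
end GNS

namespace GNS

section
variable {n : ℕ} {i0 : Fin n} {H : V n → ℝ} {G : V n → V n} {av : Fin n → ℝ} {p : V n} {L C m : ℝ}

lemma gap_aux (h : GoodHam i0 H G av p L C m) (k : Fin n) (q : ℤ) : m ≤ |(q:ℝ) - av k| ∧ 0 ≤ av k ∧ av k ≤ 2 := by
  have hm := h.mpos
  have h1 := h.av1 k
  by_cases hk : k = i0
  · subst hk
    have h2 := h.av2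
    have h3 := h.av3
    refine ⟨?_, by linarith, by linarith⟩
    rcases le_or_gt q 1 with hq | hq
    · have : (q:ℝ) ≤ 1 := by exact_mod_cast hq
      rw [abs_of_neg (by linarith)]; linarith
    · have : (2:ℝ) ≤ q := by exact_mod_cast hq
      rw [abs_of_pos (by linarith)]; linarith
  · have h2 := h.av4 k hk
    refine ⟨?_, by linarith, by linarith⟩
    rcases le_or_gt q 0 with hq | hq
    · have : (q:ℝ) ≤ 0 := by exact_mod_cast hq
      rw [abs_of_neg (by linarith)]; linarith
    · have : (1:ℝ) ≤ q := by exact_mod_cast hq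
      rw [abs_of_pos (by linarith)]; linarith

lemma coercive_aux (h : GoodHam i0 H G av p L C m) {ι : Type} [Fintype ι] (κ : ι → ℤ)
    (hκ : Function.Injective κ) (c d : EE n ι)
    (hd : d = WithLp.toLp 2 (fun i => (2 * π * κ i : ℝ) • c i - Am av (c i))) (hg : ‖gr κ G c‖ ≤ 1) :
    ‖d‖ ^ 2 ≤ 4 + 2 * C ^ 2 := by
  have hx := continuous_xx κ c
  have hdc := continuous_xx κ d
  have hA := (continuous_Am av).comp hx
  have hG := h.contG.comp hx
  have e1 := inner_gr κ G h.contG c d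
  have e2 : ∫ t in (0:ℝ)..1, inner ℝ (Am av (xx κ c t)) (xx κ d t) = ∑ i, inner ℝ (Am av (c i)) (d i) := by
    have : ∀ t, Am av (xx κ c t) = xx κ (WithLp.toLp 2 (fun i => Am av (c i)) : EE n ι) t := by
      intro t
      unfold xx
      rw [Am_sum]
      exact Finset.sum_congr rfl fun i _ => Am_smul _ _ _
    simp_rw [this]
    rw [parseval_inner κ hκ]
  have e3 : ∑ i, (2 * π * κ i) * inner ℝ (c i) (d i) - ∑ i, inner ℝ (Am av (c i)) (d i) = ‖d‖ ^ 2 := by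
    rw [PiLp.norm_sq_eq_of_L2, ← Finset.sum_sub_distrib]
    refine Finset.sum_congr rfl fun i _ => ?_
    rw [← real_inner_smul_left, ← inner_sub_left, ← real_inner_self_eq_norm_sq]
    congr 1
    rw [hd]
  have e4 : (∫ t in (0:ℝ)..1, inner ℝ (G (xx κ c t)) (xx κ d t)) - ∫ t in (0:ℝ)..1, inner ℝ (Am av (xx κ c t)) (xx κ d t)
      ≤ ∫ t in (0:ℝ)..1, (C ^ 2 / 2 + (1/2) * ‖xx κ d t‖ ^ 2) := by
    rw [← intervalIntegral.integral_sub]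
    rotate_left
    · exact (hG.inner hdc).intervalIntegrable _ _
    · exact (hA.inner hdc).intervalIntegrable _ _
    apply intervalIntegral.integral_mono_on zero_le_one
    · exact ((hG.inner hdc).sub (hA.inner hdc)).intervalIntegrable _ _
    · exact (continuous_const.add (continuous_const.mul (hdc.norm.pow 2))).intervalIntegrable _ _
    · intro t _
      rw [← inner_sub_left]
      refine (real_inner_le_norm _ _).trans ?_
      have := h.asym (xx κ c t)
      nlinarith [norm_nonneg (xx κ d t), sq_nonneg (C - ‖xx κ d t‖)]
  rw [intervalIntegral.integral_add, intervalIntegral.integral_const_mul, parseval κ hκ] at e4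
  rotate_left
  · exact continuous_const.intervalIntegrable _ _
  · exact (continuous_const.mul (hdc.norm.pow 2)).intervalIntegrable _ _
  simp only [intervalIntegral.integral_const, sub_zero, one_smul] at e4
  have e5 := real_inner_le_norm (gr κ G c) d
  have e6 : ‖gr κ G c‖ * ‖d‖ ≤ 1 * ‖d‖ := by gcongr
  nlinarith [sq_nonneg (‖d‖ - 2), norm_nonneg d]

lemma coercive (h : GoodHam i0 H G av p L C m) : ∃ B : ℝ, 0 ≤ B ∧ ∀ {ι : Type} [Fintype ι] (κ : ι → ℤ)
    (_ : Function.Injective κ) (c : EE n ι) (_ : ‖gr κ G c‖ ≤ 1),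
    ‖c‖ ^ 2 ≤ B ∧ ‖(WithLp.toLp 2 (fun i => (2 * π * κ i : ℝ) • c i) : EE n ι)‖ ^ 2 ≤ B := by
  have hm := h.mpos
  have hpi := Real.pi_pos
  set D := 4 + 2 * C ^ 2 with hD
  have hD0 : 0 ≤ D := by positivity
  refine ⟨(1 + 2 / m) ^ 2 * D + (1 / (2 * π * m)) ^ 2 * D, by positivity, ?_⟩
  intro ι _ κ hκ c hg
  have hd := coercive_aux h κ hκ c _ rfl hg
  set d : EE n ι := WithLp.toLp 2 (fun i => (2 * π * κ i : ℝ) • c i - Am av (c i)) with hdd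
  have hdi : ∀ i k, ‖d i k‖ = 2 * π * |(κ i:ℝ) - av k| * ‖c i k‖ := by
    intro i k
    have : d i k = ((2 * π * ((κ i : ℝ) - av k) : ℝ) : ℂ) * c i k := by
      simp only [hdd, PiLp.sub_apply, PiLp.smul_apply, Am_apply, Complex.real_smul]
      push_cast; ring
    rw [this, norm_mul, Complex.norm_real, Real.norm_eq_abs, abs_mul, abs_of_pos (by positivity)]
  have nsq : ∀ e : EE n ι, ‖e‖ ^ 2 = ∑ i, ∑ k, ‖e i k‖ ^ 2 := by
    intro e
    rw [PiLp.norm_sq_eq_of_L2]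
    exact Finset.sum_congr rfl fun i _ => EuclideanSpace.norm_sq_eq _
  have main : ∀ (e : EE n ι) (q : ℝ), 0 ≤ q → (∀ i k, ‖e i k‖ ≤ q * ‖d i k‖) → ‖e‖ ^ 2 ≤ q ^ 2 * D := by
    intro e q hq he
    refine le_trans ?_ (mul_le_mul_of_nonneg_left hd (by positivity))
    rw [nsq, nsq, Finset.mul_sum]
    refine Finset.sum_le_sum fun i _ => ?_
    rw [Finset.mul_sum]
    refine Finset.sum_le_sum fun k _ => ?_
    rw [← mul_pow]
    have := he i k
    gcongr
  constructor
  · have := main c (1 / (2 * π * m)) (by positivity) (by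
      intro i k
      rw [hdi, one_div, ← div_eq_inv_mul, le_div_iff₀ (by positivity)]
      have := (gap_aux h k (κ i)).1
      have := mul_le_mul_of_nonneg_right this (norm_nonneg (c i k))
      nlinarith)
    nlinarith [mul_nonneg (sq_nonneg (1 + 2 / m)) hD0]
  · have := main (WithLp.toLp 2 (fun i => (2 * π * κ i : ℝ) • c i)) (1 + 2 / m) (by positivity) (by
      intro i k
      rw [hdi]
      obtain ⟨g1, g2, g3⟩ := gap_aux h k (κ i)
      have e : ‖(WithLp.toLp 2 (fun i => (2 * π * κ i : ℝ) • c i) : EE n ι) i k‖ = 2 * π * |(κ i:ℝ)| * ‖c i k‖ := by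
        simp only [PiLp.smul_apply, norm_smul, Real.norm_eq_abs, abs_mul]
        rw [abs_of_pos hpi]; simp
      rw [e]
      have : |(κ i : ℝ)| ≤ (1 + 2 / m) * |(κ i:ℝ) - av k| := by
        have t1 : |(κ i : ℝ)| ≤ |(κ i:ℝ) - av k| + |av k| := by
          have := abs_add_le ((κ i:ℝ) - av k) (av k)
          simpa using this
        rw [abs_of_nonneg g2] at t1
        have t2 : 2 ≤ 2 / m * |(κ i:ℝ) - av k| := by
          rw [div_mul_eq_mul_div, le_div_iff₀ hm]; nlinarith
        linarith
      calc 2 * π * |(κ i:ℝ)| * ‖c i k‖ ≤ 2 * π * ((1 + 2 / m) * |(κ i:ℝ) - av k|) * ‖c i k‖ := by gcongr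
        _ = _ := by ring)
    nlinarith [mul_nonneg (sq_nonneg (1 / (2 * π * m))) hD0]

lemma hasDerivAt_xx {ι : Type} [Fintype ι] (κ : ι → ℤ) (c : EE n ι) (t : ℝ) :
    HasDerivAt (xx κ c) (Complex.I • xx κ (WithLp.toLp 2 (fun i => (2 * π * κ i : ℝ) • c i)) t) t := by
  unfold xx
  rw [Finset.smul_sum]
  refine HasDerivAt.fun_sum fun i _ => ?_
  have := (hasDerivAt_ex (κ i) t).smul_const (c i)
  convert this using 1
  ext k
  simp
  ring

lemma holder_xx {ι : Type} [Fintype ι] (κ : ι → ℤ) (hκ : Function.Injective κ) (c : EE n ι) (B : ℝ)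
    (hB : ‖(WithLp.toLp 2 (fun i => (2 * π * κ i : ℝ) • c i) : EE n ι)‖ ^ 2 ≤ B) (s t : ℝ)
    (hs : 0 ≤ s) (hst : s ≤ t) (ht : t ≤ 1) :
    ‖xx κ c t - xx κ c s‖ ≤ (B + 1) * √(t - s) := by
  set d : EE n ι := WithLp.toLp 2 (fun i => (2 * π * κ i : ℝ) • c i) with hd
  rcases eq_or_lt_of_le hst with rfl | hlt
  · simp
  have hdc := continuous_xx κ d
  have hB0 : 0 ≤ B := le_trans (sq_nonneg _) hB
  have hIc : Continuous (fun τ => Complex.I • xx κ d τ) := by fun_prop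
  have e1 : xx κ c t - xx κ c s = ∫ τ in s..t, Complex.I • xx κ d τ := by
    rw [intervalIntegral.integral_eq_sub_of_hasDerivAt (fun τ _ => hasDerivAt_xx κ c τ)]
    exact hIc.intervalIntegrable _ _
  set lam := √(t - s) with hlam
  have hl : 0 < lam := Real.sqrt_pos.2 (by linarith)
  have hl2 : lam ^ 2 = t - s := Real.sq_sqrt (by linarith)
  have hintg : ∀ a b : ℝ, IntervalIntegrable (fun τ => ‖xx κ d τ‖ ^ 2) volume a b := fun a b =>
    (hdc.norm.pow 2).intervalIntegrable _ _
  have e2 : ∫ τ in s..t, ‖xx κ d τ‖ ^ 2 ≤ B := by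
    refine le_trans ?_ hB
    rw [← parseval κ hκ]
    apply intervalIntegral.integral_mono_interval hs hst ht
    · exact Filter.Eventually.of_forall fun τ => by positivity
    · exact hintg _ _
  rw [e1]
  calc ‖∫ τ in s..t, Complex.I • xx κ d τ‖ ≤ ∫ τ in s..t, ‖Complex.I • xx κ d τ‖ :=
        intervalIntegral.norm_integral_le_integral_norm hst
    _ ≤ ∫ τ in s..t, (lam / 2 * ‖xx κ d τ‖ ^ 2 + 1 / (2 * lam)) := by
        apply intervalIntegral.integral_mono_on hst
        · exact hIc.norm.intervalIntegrable _ _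
        · exact ((continuous_const.mul (hdc.norm.pow 2)).add continuous_const).intervalIntegrable _ _
        · intro τ _
          rw [norm_smul, Complex.norm_I, one_mul]
          have : 0 ≤ (lam * ‖xx κ d τ‖ - 1) ^ 2 / (2 * lam) := by positivity
          have e : (lam * ‖xx κ d τ‖ - 1) ^ 2 / (2 * lam) = lam / 2 * ‖xx κ d τ‖ ^ 2 + 1 / (2 * lam) - ‖xx κ d τ‖ := by
            field_simp; ring
          linarith
    _ = lam / 2 * (∫ τ in s..t, ‖xx κ d τ‖ ^ 2) + (t - s) * (1 / (2 * lam)) := by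
        rw [intervalIntegral.integral_add ((hintg s t).const_mul _) (continuous_const.intervalIntegrable _ _),
          intervalIntegral.integral_const_mul]
        simp
        ring
    _ ≤ lam / 2 * B + (t - s) * (1 / (2 * lam)) := by gcongr
    _ = (B / 2 + 1 / 2) * lam := by
        rw [← hl2]; field_simp
    _ ≤ (B + 1) * lam := by gcongr <;> linarith

end
end GNS

namespace GNS

lemma fourier_const_scalar (f : ℝ → ℂ) (hf : Continuous f) (h01 : f 0 = f 1)
    (hk : ∀ k : ℤ, k ≠ 0 → ∫ t in (0:ℝ)..1, ex (-k) t * f t = 0) : ∀ t ∈ Set.Icc (0:ℝ) 1, f t = f 0 := by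
  have : Fact ((0:ℝ) < 1) := ⟨one_pos⟩
  have hc : Continuous (AddCircle.liftIco (1:ℝ) 0 f) :=
    AddCircle.liftIco_zero_continuous h01 hf.continuousOn
  set F : C(AddCircle (1:ℝ), ℂ) := ⟨_, hc⟩ with hF
  have hcoef : ∀ k : ℤ, k ≠ 0 → fourierCoeff F k = 0 := by
    intro k hk0
    have : fourierCoeff F k = fourierCoeffOn (lt_add_of_pos_right (0:ℝ) one_pos) f k :=
      fourierCoeff_liftIco_eq f k
    rw [this, fourierCoeffOn_eq_integral]
    have h2 := hk k hk0
    have : ∀ t : ℝ, (fourier (-k) (t : AddCircle ((0:ℝ) + 1 - 0))) • f t = ex (-k) t * f t := by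
      intro t
      rw [fourier_coe_apply, smul_eq_mul]
      congr 1
      unfold ex
      congr 1
      push_cast
      simp
      ring
    simp_rw [this]
    simp only [zero_add]
    rw [h2, smul_zero]
  have hsum : Summable (fourierCoeff F) := by
    apply summable_of_ne_finset_zero (s := {0})
    intro b hb
    exact hcoef b (by simpa using hb)
  have hval : ∀ y, F y = fourierCoeff F 0 := by
    intro y
    have h1 := has_pointwise_sum_fourier_series_of_summable hsum y
    have h2 := hasSum_single (f := fun i => fourierCoeff F i • fourier i y) (0 : ℤ) (by
      intro b hb
      rw [hcoef b hb, zero_smul])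
    have := h1.unique h2
    simpa using this
  have hco : ∀ t ∈ Set.Ico (0:ℝ) 1, f t = fourierCoeff F 0 := by
    intro t ht
    rw [← hval (t : AddCircle (1:ℝ))]
    exact (AddCircle.liftIco_zero_coe_apply ht).symm
  have h0 := hco 0 (by simp)
  intro t ht
  rcases eq_or_lt_of_le ht.2 with h | h
  · rw [h, h01]
  · rw [hco t ⟨ht.1, h⟩, h0]

lemma fourier_const {n : ℕ} (f : ℝ → V n) (hf : Continuous f) (h01 : f 0 = f 1)
    (hk : ∀ k : ℤ, k ≠ 0 → ∫ t in (0:ℝ)..1, ex (-k) t • f t = 0) : ∀ t ∈ Set.Icc (0:ℝ) 1, f t = f 0 := by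
  intro t ht
  ext l
  refine fourier_const_scalar (fun t => f t l) (by fun_prop) (by rw [h01]) ?_ t ht
  intro k hk0
  have h1 : IntervalIntegrable (fun t => ex (-k) t • f t) volume 0 1 :=
    ((continuous_ex _).smul hf).intervalIntegrable _ _
  have := (EuclideanSpace.proj (𝕜 := ℂ) l : V n →L[ℂ] ℂ).intervalIntegral_comp_comm (μ := volume) h1
  rw [hk k hk0] at this
  simpa using this

lemma limit_eq {n : ℕ} (y Γ : ℝ → V n) (hy : Continuous y) (hΓ : Continuous Γ) (h01 : y 0 = y 1)
    (hk : ∀ k : ℤ, (2 * π * k : ℝ) • ∫ t in (0:ℝ)..1, ex (-k) t • y t = ∫ t in (0:ℝ)..1, ex (-k) t • Γ t) :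
    ∀ t ∈ Set.Icc (0:ℝ) 1, y t = y 0 + Complex.I • ∫ s in (0:ℝ)..t, Γ s := by
  have hintg : ∀ a b : ℝ, IntervalIntegrable Γ volume a b := fun a b => hΓ.intervalIntegrable a b
  have hder : ∀ t, HasDerivAt (fun t => ∫ s in (0:ℝ)..t, Γ s) (Γ t) t := fun t =>
    intervalIntegral.integral_hasDerivAt_right (hintg _ _) (hΓ.stronglyMeasurableAtFilter _ _) hΓ.continuousAt
  have hIc : Continuous (fun t => ∫ s in (0:ℝ)..t, Γ s) :=
    continuous_iff_continuousAt.2 fun t => (hder t).continuousAt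
  set D : ℝ → V n := fun t => ∫ s in (0:ℝ)..t, Γ s with hD
  have hD0 : D 0 = 0 := by simp [hD]
  have hD1 : D 1 = 0 := by
    have := hk 0
    simp [ex_zero] at this
    simp [hD, this]
  have main := fourier_const (fun t => y t - Complex.I • D t) (by fun_prop) (by simp [hD0, hD1, h01]) ?_
  · intro t ht
    have := main t ht
    simp only [hD0, smul_zero, sub_zero] at this
    rw [← this]; simp [hD]
  intro k hk0
  have hkc : (k : ℂ) ≠ 0 := by exact_mod_cast hk0
  have c1 : Continuous (fun t => ex (-k) t • y t) := (continuous_ex _).smul hy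
  have c2 : Continuous (fun t => ex (-k) t • D t) := (continuous_ex _).smul hIc
  have c4 : ∀ a : ℂ, Continuous (fun t => a • ex (-k) t • D t) := fun a => by fun_prop
  have c3 : Continuous (fun t => ex (-k) t • Γ t) := (continuous_ex _).smul hΓ
  have hne : (2 * π * ((-k : ℤ) : ℂ) * Complex.I : ℂ) ≠ 0 := by
    simp [hkc, Real.pi_ne_zero]
  have parts : (∫ t in (0:ℝ)..1, ex (-k) t • Γ t)
      + (2 * π * ((-k : ℤ) : ℂ) * Complex.I : ℂ) • ∫ t in (0:ℝ)..1, ex (-k) t • D t = 0 := by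
    have h1 : ∀ t ∈ Set.uIcc (0:ℝ) 1, HasDerivAt (fun t => ex (-k) t • D t)
        (ex (-k) t • Γ t + (2 * π * ((-k : ℤ) : ℂ) * Complex.I : ℂ) • (ex (-k) t • D t)) t := by
      intro t _
      have := (hasDerivAt_ex (-k) t).smul (hder t)
      rw [smul_smul]
      exact this
    have h2 := intervalIntegral.integral_eq_sub_of_hasDerivAt h1 (by
      apply Continuous.intervalIntegrable
      exact c3.add (c4 _))
    rw [intervalIntegral.integral_add (c3.intervalIntegrable _ _) ((c4 _).intervalIntegrable _ _),
      intervalIntegral.integral_smul, hD0, hD1] at h2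
    simpa using h2
  rw [← hk k] at parts
  have e : ∀ t, ex (-k) t • (y t - Complex.I • D t) = ex (-k) t • y t - Complex.I • (ex (-k) t • D t) := by
    intro t
    rw [smul_sub, smul_comm]
  simp_rw [e]
  rw [intervalIntegral.integral_sub (c1.intervalIntegrable _ _) ((c4 _).intervalIntegrable _ _),
    intervalIntegral.integral_smul]
  have e2 : ((2 * π * k : ℝ) • ∫ t in (0:ℝ)..1, ex (-k) t • y t)
      = (2 * π * k : ℂ) • ∫ t in (0:ℝ)..1, ex (-k) t • y t := by
    ext l; simp
  rw [e2] at parts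
  have hne2 : (2 * π * k : ℂ) ≠ 0 := by simp [hkc, Real.pi_ne_zero]
  apply smul_right_injective (V n) hne2
  simp only [smul_zero]
  rw [smul_sub, ← parts, smul_smul]
  rw [sub_eq_add_neg, ← neg_smul]
  congr 2
  push_cast; ring

lemma ascoli {n : ℕ} (x : ℕ → ℝ → V n) (hx : ∀ N, Continuous (x N)) (B M : ℝ)
    (hB : ∀ N, ∀ t ∈ Set.Icc (0:ℝ) 1, ‖x N t‖ ≤ B)
    (hM : ∀ N, ∀ s ∈ Set.Icc (0:ℝ) 1, ∀ t ∈ Set.Icc (0:ℝ) 1, ‖x N t - x N s‖ ≤ M * √|t - s|) :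
    ∃ (φ : ℕ → ℕ) (y : ℝ → V n), StrictMono φ ∧ Continuous y ∧
      ∀ t ∈ Set.Icc (0:ℝ) 1, Filter.Tendsto (fun N => x (φ N) t) Filter.atTop (nhds (y t)) := by
  let f : ℕ → BoundedContinuousFunction (Set.Icc (0:ℝ) 1) (V n) := fun N =>
    BoundedContinuousFunction.mkOfCompact ⟨fun t => x N t, (hx N).comp continuous_subtype_val⟩
  have hcomp := BoundedContinuousFunction.arzela_ascoli (Metric.closedBall (0 : V n) B)
    (isCompact_closedBall _ _) (Set.range f) (by
      rintro _ t ⟨N, rfl⟩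
      simpa [f] using hB N t t.2) (by
      refine Metric.equicontinuous_of_continuity_modulus (fun d => M * √|d|) ?_ _ ?_
      · have : Continuous (fun d : ℝ => M * √|d|) := by fun_prop
        simpa using this.tendsto 0
      · rintro s t ⟨_, N, rfl⟩
        have := hM N t t.2 s s.2
        rw [dist_eq_norm, Subtype.dist_eq, Real.dist_eq, abs_abs]
        exact this)
  obtain ⟨g, _, φ, hφ, hlim⟩ := hcomp.tendsto_subseq (x := f) (fun N => subset_closure ⟨N, rfl⟩)
  refine ⟨φ, Set.IccExtend zero_le_one g, hφ, g.continuous.Icc_extend', ?_⟩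
  intro t ht
  rw [Set.IccExtend_of_mem _ _ ht]
  have h1 := (BoundedContinuousFunction.tendsto_iff_tendstoUniformly.1 hlim).tendsto_at ⟨t, ht⟩
  exact h1

lemma lim_int {n : ℕ} {F : Type*} [NormedAddCommGroup F] [NormedSpace ℝ F] (Φ : ℝ × V n → F) (hΦ : Continuous Φ)
    (x : ℕ → ℝ → V n) (y : ℝ → V n) (hx : ∀ N, Continuous (x N)) (B : ℝ)
    (hB : ∀ N, ∀ t ∈ Set.Icc (0:ℝ) 1, ‖x N t‖ ≤ B)
    (hlim : ∀ t ∈ Set.Icc (0:ℝ) 1, Filter.Tendsto (fun N => x N t) Filter.atTop (nhds (y t))) :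
    Filter.Tendsto (fun N => ∫ t in (0:ℝ)..1, Φ (t, x N t)) Filter.atTop (nhds (∫ t in (0:ℝ)..1, Φ (t, y t))) := by
  obtain ⟨K, hK⟩ := ((isCompact_Icc (a := (0:ℝ)) (b := 1)).prod (isCompact_closedBall (0 : V n) B)).exists_bound_of_continuousOn
    hΦ.continuousOn
  apply intervalIntegral.tendsto_integral_filter_of_dominated_convergence (fun _ => K)
  · refine Filter.Eventually.of_forall fun N => ?_
    exact (hΦ.comp (continuous_id.prodMk (hx N))).aestronglyMeasurable
  · refine Filter.Eventually.of_forall fun N => Filter.Eventually.of_forall fun t ht => ?_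
    rw [Set.uIoc_of_le zero_le_one] at ht
    have ht' : t ∈ Set.Icc (0:ℝ) 1 := ⟨ht.1.le, ht.2⟩
    exact hK _ ⟨ht', by simpa using hB N t ht'⟩
  · exact intervalIntegrable_const
  · refine Filter.Eventually.of_forall fun t ht => ?_
    rw [Set.uIoc_of_le zero_le_one] at ht
    have ht' : t ∈ Set.Icc (0:ℝ) 1 := ⟨ht.1.le, ht.2⟩
    exact (hΦ.tendsto _).comp (tendsto_const_nhds.prodMk_nhds (hlim t ht'))

end GNS

namespace GNS

section
variable {n : ℕ} {i0 : Fin n} {H : V n → ℝ} {G : V n → V n} {av : Fin n → ℝ} {p : V n} {L C m : ℝ}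

lemma act_eq (hG : Continuous G) {ι : Type} [Fintype ι] (κ : ι → ℤ) (c : EE n ι) :
    act κ H c = (1/2) * inner ℝ (gr κ G c) c + (1/2) * (∫ t in (0:ℝ)..1, inner ℝ (G (xx κ c t)) (xx κ c t))
      - ∫ t in (0:ℝ)..1, H (xx κ c t) := by
  rw [inner_gr κ G hG]
  unfold act
  have : ∑ i, 2 * π * (κ i : ℝ) * inner ℝ (c i) (c i) = 2 * (π * ∑ i, (κ i : ℝ) * ‖c i‖ ^ 2) := by
    rw [Finset.mul_sum, Finset.mul_sum]
    refine Finset.sum_congr rfl fun i _ => ?_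
    rw [real_inner_self_eq_norm_sq]; ring
  rw [this]; ring

lemma xx_zero_one {ι : Type} [Fintype ι] (κ : ι → ℤ) (c : EE n ι) : xx κ c 0 = xx κ c 1 := by
  simp [xx, ex_at_zero, ex_at_one]

lemma sup_xx {ι : Type} [Fintype ι] (κ : ι → ℤ) (hκ : Function.Injective κ) (c : EE n ι) (B : ℝ) (j : ι)
    (hj : κ j = 0) (hc : ‖c‖ ^ 2 ≤ B) (hM : ∀ s ∈ Set.Icc (0:ℝ) 1, ∀ t ∈ Set.Icc (0:ℝ) 1, ‖xx κ c t - xx κ c s‖ ≤ B + 1)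
    (t : ℝ) (ht : t ∈ Set.Icc (0:ℝ) 1) : ‖xx κ c t‖ ≤ 2 * (B + 1) := by
  have h1 := coeff_xx κ hκ c j
  simp only [hj, neg_zero, ex_zero, one_smul] at h1
  have h2 : xx κ c t = c j + ∫ s in (0:ℝ)..1, (xx κ c t - xx κ c s) := by
    rw [intervalIntegral.integral_sub intervalIntegrable_const ((continuous_xx κ c).intervalIntegrable _ _), h1]
    simp
  have h3 : ‖∫ s in (0:ℝ)..1, (xx κ c t - xx κ c s)‖ ≤ (B + 1) * |1 - 0| := by
    apply intervalIntegral.norm_integral_le_of_norm_le_const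
    intro s hs
    rw [Set.uIoc_of_le zero_le_one] at hs
    exact hM s ⟨hs.1.le, hs.2⟩ t ht
  have h4 : ‖c j‖ ≤ ‖c‖ := PiLp.norm_apply_le c j
  have h5 : ‖c‖ ≤ B + 1 := by nlinarith [sq_nonneg (‖c‖ - 1), norm_nonneg c]
  rw [h2]
  refine (norm_add_le _ _).trans ?_
  simp at h3
  linarith

theorem periodic_orbit (h : GoodHam i0 H G av p L C m) : ∃ y : ℝ → V n, Continuous y ∧ y 0 = y 1 ∧
    (∀ t ∈ Set.Icc (0:ℝ) 1, HasDerivAt y (Complex.I • G (y t)) t) ∧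
    0 < (1/2) * (∫ t in (0:ℝ)..1, inner ℝ (G (y t)) (y t)) - ∫ t in (0:ℝ)..1, H (y t) := by
  obtain ⟨α, hα, hgal⟩ := galerkin h
  obtain ⟨B, hB0, hB⟩ := coercive h
  have hGc := h.contG
  have hε : ∀ N : ℕ, (0:ℝ) < 1 / ((N:ℝ) + 1) := fun N => by positivity
  choose c hc1 hc2 using fun N : ℕ => hgal N (1 / ((N:ℝ) + 1)) (hε N)
  have hg1 : ∀ N, ‖gr (kk N) G (c N)‖ ≤ 1 := by
    intro N
    refine (hc2 N).le.trans ?_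
    rw [div_le_one (by positivity)]
    have : (0:ℝ) ≤ N := by positivity
    linarith
  set x : ℕ → ℝ → V n := fun N => xx (kk N) (c N) with hx
  have hxc : ∀ N, Continuous (x N) := fun N => continuous_xx _ _
  have hb1 : ∀ N, ‖c N‖ ^ 2 ≤ B := fun N => (hB (kk N) (kk_inj N) (c N) (hg1 N)).1
  have hb2 := fun N => (hB (kk N) (kk_inj N) (c N) (hg1 N)).2
  have hM : ∀ N, ∀ s ∈ Set.Icc (0:ℝ) 1, ∀ t ∈ Set.Icc (0:ℝ) 1, ‖x N t - x N s‖ ≤ (B + 1) * √|t - s| := by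
    intro N s hs t ht
    rcases le_total s t with hst | hst
    · rw [abs_of_nonneg (by linarith)]
      exact holder_xx (kk N) (kk_inj N) (c N) B (hb2 N) s t hs.1 hst ht.2
    · rw [abs_sub_comm, abs_of_nonneg (by linarith), norm_sub_rev]
      exact holder_xx (kk N) (kk_inj N) (c N) B (hb2 N) t s ht.1 hst hs.2
  have hS : ∀ N, ∀ t ∈ Set.Icc (0:ℝ) 1, ‖x N t‖ ≤ 2 * (B + 1) := by
    intro N t ht
    refine sup_xx (kk N) (kk_inj N) (c N) B (Sum.inl 0) (by simp [kk]) (hb1 N) ?_ t ht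
    intro s hs t ht
    refine (hM N s hs t ht).trans ?_
    have : √|t - s| ≤ 1 := by
      rw [Real.sqrt_le_one, abs_le]
      constructor <;> linarith [hs.1, hs.2, ht.1, ht.2]
    nlinarith
  obtain ⟨φ, y, hφ, hyc, hlim⟩ := ascoli x hxc _ _ hS hM
  have hφt := hφ.tendsto_atTop
  have hlimI : ∀ {F : Type} [NormedAddCommGroup F] [NormedSpace ℝ F] (Φ : ℝ × V n → F), Continuous Φ →
      Filter.Tendsto (fun N => ∫ t in (0:ℝ)..1, Φ (t, x (φ N) t)) Filter.atTop
        (nhds (∫ t in (0:ℝ)..1, Φ (t, y t))) := fun Φ hΦ =>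
    lim_int Φ hΦ (fun N => x (φ N)) y (fun N => hxc _) _ (fun N => hS _) hlim
  have heps : Filter.Tendsto (fun N : ℕ => 1 / (((φ N : ℕ) : ℝ) + 1)) Filter.atTop (nhds 0) :=
    (tendsto_one_div_add_atTop_nhds_zero_nat (𝕜 := ℝ)).comp hφt
  have h01 : y 0 = y 1 := by
    have l0 := hlim 0 (by simp)
    have l1 := hlim 1 (by simp)
    have : (fun N => x (φ N) 0) = fun N => x (φ N) 1 := funext fun N => xx_zero_one _ _
    rw [this] at l0
    exact tendsto_nhds_unique l0 l1
  have hfour : ∀ k : ℤ, (2 * π * k : ℝ) • ∫ t in (0:ℝ)..1, ex (-k) t • y t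
      = ∫ t in (0:ℝ)..1, ex (-k) t • G (y t) := by
    intro k
    have cex : Continuous (fun q : ℝ × V n => ex (-k) q.1) := (continuous_ex _).comp continuous_fst
    have l1 := hlimI (fun q => ex (-k) q.1 • q.2) (cex.smul continuous_snd)
    have l2 := hlimI (fun q => ex (-k) q.1 • G q.2) (cex.smul (hGc.comp continuous_snd))
    have l3 := (l1.const_smul (2 * π * k : ℝ)).sub l2
    rw [← sub_eq_zero]
    refine tendsto_nhds_unique l3 ?_
    refine squeeze_zero_norm' ?_ heps
    have hev : ∀ᶠ N in Filter.atTop, k.natAbs ≤ φ N := hφt.eventually_ge_atTop _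
    filter_upwards [hev] with N hN
    obtain ⟨i, hi⟩ := kk_surj (φ N) k (by rw [Int.abs_eq_natAbs]; exact_mod_cast hN)
    have e1 := coeff_xx (kk (φ N)) (kk_inj _) (c (φ N)) i
    rw [hi] at e1
    have e2 : gr (kk (φ N)) G (c (φ N)) i = (2 * π * k : ℝ) • c (φ N) i
        - ∫ t in (0:ℝ)..1, ex (-k) t • G (x (φ N) t) := by
      simp only [gr, hi, hx]
    have e3 := PiLp.norm_apply_le (gr (kk (φ N)) G (c (φ N))) i
    rw [e2] at e3
    simp only [hx] at e3 ⊢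
    rw [e1]
    exact e3.trans (hc2 _).le
  have heq := limit_eq y (fun t => G (y t)) hyc (hGc.comp hyc) h01 hfour
  -- action
  have hact : α ≤ (1/2) * (∫ t in (0:ℝ)..1, inner ℝ (G (y t)) (y t)) - ∫ t in (0:ℝ)..1, H (y t) := by
    have l1 := hlimI (fun q => inner ℝ (G q.2) q.2) ((hGc.comp continuous_snd).inner continuous_snd)
    have l2 := hlimI (fun q => H q.2) (h.cont.comp continuous_snd)
    have l3 := ((heps.const_mul (1/2 * (B + 1))).add (l1.const_mul (1/2))).sub l2
    simp only [mul_zero, zero_add] at l3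
    refine ge_of_tendsto l3 (Filter.Eventually.of_forall fun N => ?_)
    have e1 := hc1 (φ N)
    rw [act_eq (H := H) hGc] at e1
    have e2 := real_inner_le_norm (gr (kk (φ N)) G (c (φ N))) (c (φ N))
    have e3 : ‖c (φ N)‖ ≤ B + 1 := by
      have := hb1 (φ N)
      nlinarith [sq_nonneg (‖c (φ N)‖ - 1), norm_nonneg (c (φ N))]
    have e4 : ‖gr (kk (φ N)) G (c (φ N))‖ * ‖c (φ N)‖ ≤ 1 / (((φ N : ℕ) : ℝ) + 1) * (B + 1) := by
      have := (hc2 (φ N)).le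
      gcongr
    simp only [hx]
    linarith
  -- the smooth extension
  have hΓ : Continuous (fun t => Complex.I • G (y t)) := by
    have := hGc.comp hyc
    fun_prop
  set Y : ℝ → V n := fun t => y 0 + ∫ s in (0:ℝ)..t, Complex.I • G (y s) with hY
  have hder : ∀ t, HasDerivAt Y (Complex.I • G (y t)) t := fun t =>
    (intervalIntegral.integral_hasDerivAt_right (hΓ.intervalIntegrable _ _)
      (hΓ.stronglyMeasurableAtFilter _ _) hΓ.continuousAt).const_add _
  have hYy : ∀ t ∈ Set.Icc (0:ℝ) 1, Y t = y t := by
    intro t ht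
    rw [heq t ht, hY]
    simp only [intervalIntegral.integral_smul]
  refine ⟨Y, continuous_iff_continuousAt.2 fun t => (hder t).continuousAt, ?_, ?_, ?_⟩
  · rw [hYy 0 (by simp), hYy 1 (by simp), h01]
  · intro t ht
    rw [hYy t ht]; exact hder t
  · have i1 : ∫ t in (0:ℝ)..1, inner ℝ (G (Y t)) (Y t) = ∫ t in (0:ℝ)..1, inner ℝ (G (y t)) (y t) := by
      apply intervalIntegral.integral_congr
      intro t ht
      rw [Set.uIcc_of_le zero_le_one] at ht
      simp only [hYy t ht]
    have i2 : ∫ t in (0:ℝ)..1, H (Y t) = ∫ t in (0:ℝ)..1, H (y t) := by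
      apply intervalIntegral.integral_congr
      intro t ht
      rw [Set.uIcc_of_le zero_le_one] at ht
      simp only [hYy t ht]
    rw [i1, i2]
    linarith

end
end GNS

namespace GNS

lemma contDiff_primitive (χ : ℝ → ℝ) (hχ : ContDiff ℝ 2 χ) :
    ContDiff ℝ 2 (fun s => ∫ u in (0:ℝ)..s, χ u) ∧
      ∀ s, HasDerivAt (fun s => ∫ u in (0:ℝ)..s, χ u) (χ s) s := by
  have hc := hχ.continuous
  have hder : ∀ s, HasDerivAt (fun s => ∫ u in (0:ℝ)..s, χ u) (χ s) s := fun s =>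
    intervalIntegral.integral_hasDerivAt_right (hc.intervalIntegrable _ _)
      (hc.stronglyMeasurableAtFilter _ _) hc.continuousAt
  refine ⟨?_, hder⟩
  have : (2 : WithTop ℕ∞) = 1 + 1 := by norm_num
  rw [this, contDiff_succ_iff_deriv]
  refine ⟨fun s => (hder s).differentiableAt, by simp, ?_⟩
  have e : deriv (fun s => ∫ u in (0:ℝ)..s, χ u) = χ := funext fun s => (hder s).deriv
  rw [e]
  exact hχ.of_le (by norm_num)

lemma exists_f (ℓ : ℝ) (hℓ : 0 < ℓ) : ∃ f f' : ℝ → ℝ, ContDiff ℝ 2 f ∧ (∀ s, HasDerivAt f (f' s) s) ∧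
    (∀ s, 0 ≤ f' s) ∧ (∀ s, f' s ≤ 1) ∧ (∀ s, s ≤ 0 → f s = 0) ∧ (∀ s, s ≤ 0 → f' s = 0) ∧
    (∀ s, ℓ ≤ s → f' s = 1) ∧ (∀ s, ℓ ≤ s → f s = f ℓ + s - ℓ) ∧ (∀ s, 0 ≤ f s) := by
  set χ : ℝ → ℝ := fun s => Real.smoothTransition (s / ℓ) with hχ
  have hχd : ContDiff ℝ 2 χ := Real.smoothTransition.contDiff.comp (contDiff_id.div_const ℓ)
  obtain ⟨h1, h2⟩ := contDiff_primitive χ hχd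
  have hc := hχd.continuous
  have z : ∀ s, s ≤ 0 → χ s = 0 := fun s hs =>
    Real.smoothTransition.zero_of_nonpos (div_nonpos_of_nonpos_of_nonneg hs hℓ.le)
  have o : ∀ s, ℓ ≤ s → χ s = 1 := fun s hs =>
    Real.smoothTransition.one_of_one_le (by rwa [le_div_iff₀ hℓ, one_mul])
  have z2 : ∀ s, s ≤ 0 → ∫ u in (0:ℝ)..s, χ u = 0 := by
    intro s hs
    rw [intervalIntegral.integral_congr (g := fun _ => (0:ℝ))]
    · simp
    · intro u hu
      rw [Set.uIcc_of_ge hs] at hu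
      exact z u hu.2
  refine ⟨_, χ, h1, h2, fun s => Real.smoothTransition.nonneg _, fun s => Real.smoothTransition.le_one _,
    z2, z, o, ?_, ?_⟩
  · intro s hs
    have := intervalIntegral.integral_add_adjacent_intervals (hc.intervalIntegrable (μ := volume) 0 ℓ) (hc.intervalIntegrable ℓ s)
    rw [← this]
    have e : ∫ u in ℓ..s, χ u = s - ℓ := by
      rw [intervalIntegral.integral_congr (g := fun _ => (1:ℝ))]
      · simp
      · intro u hu
        rw [Set.uIcc_of_le hs] at hu
        exact o u hu.1
    rw [e]; ring
  · intro s
    rcases le_total s 0 with hs | hs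
    · exact (z2 s hs).ge
    · exact intervalIntegral.integral_nonneg hs fun u _ => Real.smoothTransition.nonneg _

lemma exists_h (a b : ℝ) (ha : 0 < a) (hab : a < b) : ∃ (h h' : ℝ → ℝ) (m e : ℝ), ContDiff ℝ 2 h ∧
    (∀ s, HasDerivAt h (h' s) s) ∧ (∀ s, 0 ≤ h' s) ∧ (∀ s, h' s < 1) ∧ 0 < e ∧ e < b ∧ (∀ s, s ≤ e → h s = 0) ∧
    (∀ s, b - e ≤ s → h s = m) ∧ a < m ∧ (∀ s, 0 ≤ h s) := by
  set e : ℝ := (b - a) / 16 with he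
  have he0 : 0 < e := by rw [he]; linarith
  set lam : ℝ := (a + e) / (a + 2 * e) with hlam
  have hl0 : 0 < lam := by positivity
  have hl1 : lam < 1 := by rw [hlam, div_lt_one (by positivity)]; linarith
  set χ : ℝ → ℝ := fun s => lam * (Real.smoothTransition (s / e - 1) * Real.smoothTransition ((b - s) / e - 1)) with hχ
  have hχd : ContDiff ℝ 2 χ := by
    refine contDiff_const.mul (ContDiff.mul ?_ ?_)
    · exact Real.smoothTransition.contDiff.comp ((contDiff_id.div_const e).sub contDiff_const)
    · exact Real.smoothTransition.contDiff.comp (((contDiff_const.sub contDiff_id).div_const e).sub contDiff_const)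
  obtain ⟨h1, h2⟩ := contDiff_primitive χ hχd
  have hc := hχd.continuous
  have hχ0 : ∀ s, 0 ≤ χ s := fun s =>
    mul_nonneg hl0.le (mul_nonneg (Real.smoothTransition.nonneg _) (Real.smoothTransition.nonneg _))
  have hχ1 : ∀ s, χ s < 1 := by
    intro s
    refine lt_of_le_of_lt ?_ hl1
    refine mul_le_of_le_one_right hl0.le ?_
    exact mul_le_one₀ (Real.smoothTransition.le_one _) (Real.smoothTransition.nonneg _) (Real.smoothTransition.le_one _)
  have z : ∀ s, s ≤ e → χ s = 0 := by
    intro s hs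
    have : s / e - 1 ≤ 0 := by rw [sub_nonpos, div_le_one he0]; exact hs
    simp [hχ, Real.smoothTransition.zero_of_nonpos this]
  have z' : ∀ s, b - e ≤ s → χ s = 0 := by
    intro s hs
    have : (b - s) / e - 1 ≤ 0 := by rw [sub_nonpos, div_le_one he0]; linarith
    simp [hχ, Real.smoothTransition.zero_of_nonpos this]
  have o : ∀ s, 2 * e ≤ s → s ≤ b - 2 * e → χ s = lam := by
    intro s hs hs'
    have t1 : 1 ≤ s / e - 1 := by
      have : 2 ≤ s / e := by rw [le_div_iff₀ he0]; linarith
      linarith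
    have t2 : 1 ≤ (b - s) / e - 1 := by
      have : 2 ≤ (b - s) / e := by rw [le_div_iff₀ he0]; linarith
      linarith
    simp [hχ, Real.smoothTransition.one_of_one_le t1, Real.smoothTransition.one_of_one_le t2]
  have hi : ∀ s t : ℝ, IntervalIntegrable χ volume s t := fun s t => hc.intervalIntegrable _ _
  have z2 : ∀ s, s ≤ e → ∫ u in (0:ℝ)..s, χ u = 0 := by
    intro s hs
    rw [intervalIntegral.integral_congr (g := fun _ => (0:ℝ))]
    · simp
    · intro u hu
      rw [Set.mem_uIcc] at hu
      apply z
      rcases hu with hu | hu <;> linarith [hu.1, hu.2]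
  refine ⟨_, χ, ∫ u in (0:ℝ)..(b - e), χ u, e, h1, h2, hχ0, hχ1, he0, by rw [he]; linarith, z2, ?_, ?_, ?_⟩
  · intro s hs
    rw [← intervalIntegral.integral_add_adjacent_intervals (hi 0 (b - e)) (hi (b - e) s)]
    have e : ∫ u in (b - e)..s, χ u = 0 := by
      rw [intervalIntegral.integral_congr (g := fun _ => (0:ℝ))]
      · simp
      · intro u hu
        rw [Set.uIcc_of_le hs] at hu
        exact z' u hu.1
    rw [e, add_zero]
  · have t1 : ∫ u in (2 * e)..(b - 2 * e), χ u ≤ ∫ u in (0:ℝ)..(b - e), χ u := by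
      apply intervalIntegral.integral_mono_interval (by linarith) (by linarith) (by linarith)
      · exact Filter.Eventually.of_forall hχ0
      · exact hi _ _
    have t2 : ∫ u in (2 * e)..(b - 2 * e), χ u = (b - 4 * e) * lam := by
      rw [intervalIntegral.integral_congr (g := fun _ => lam)]
      · simp; left; ring
      · intro u hu
        rw [Set.uIcc_of_le (by linarith)] at hu
        exact o u hu.1 hu.2
    have t3 : a + 2 * e ≤ b - 4 * e := by linarith
    have t4 : (a + 2 * e) * lam = a + e := by rw [hlam]; field_simp
    have t5 : (a + 2 * e) * lam ≤ (b - 4 * e) * lam := by gcongr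
    linarith
  · intro s
    rcases le_total s 0 with hs | hs
    · exact (z2 s (by linarith)).ge
    · exact intervalIntegral.integral_nonneg hs fun u _ => hχ0 u

end GNS

namespace GNS
variable {n : ℕ}

/-- Quadratic Hamiltonian. -/
noncomputable def Qf (av : Fin n → ℝ) (z : V n) : ℝ := π * ∑ k, av k * ‖z k‖ ^ 2

lemma Qf_eq (av : Fin n → ℝ) (z : V n) : Qf av z = (1/2) * inner ℝ (Am av z) z := by
  rw [inner_Am, Qf, Finset.mul_sum, Finset.mul_sum]
  exact Finset.sum_congr rfl fun k _ => by ring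

lemma Am_add (av : Fin n → ℝ) (z w : V n) : Am av (z + w) = Am av z + Am av w := by
  ext k; simp [Am_apply]; ring

lemma Am_sub (av : Fin n → ℝ) (z w : V n) : Am av (z - w) = Am av z - Am av w := by
  ext k; simp [Am_apply]; ring

lemma inner_Am_symm (av : Fin n → ℝ) (z w : V n) : inner ℝ (Am av z) w = inner ℝ z (Am av w) := by
  simp only [PiLp.inner_apply, Complex.inner, Am_apply]
  refine Finset.sum_congr rfl fun i _ => ?_
  simp; ring

lemma Qf_add (av : Fin n → ℝ) (z v : V n) : Qf av (z + v) = Qf av z + inner ℝ (Am av z) v + Qf av v := by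
  simp only [Qf_eq]
  rw [Am_add, inner_add_left, inner_add_right, inner_add_right, inner_Am_symm av v z,
    real_inner_comm (Am av z) v]
  ring

lemma norm_Am_le (av : Fin n → ℝ) (a : ℝ) (ha : ∀ k, |av k| ≤ a) (ha0 : 0 ≤ a) (z : V n) :
    ‖Am av z‖ ≤ 2 * π * a * ‖z‖ := by
  have hpi := Real.pi_pos
  refine le_of_sq_le_sq ?_ (by positivity) 
  rw [mul_pow, EuclideanSpace.norm_sq_eq, EuclideanSpace.norm_sq_eq, Finset.mul_sum]
  refine Finset.sum_le_sum fun k _ => ?_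
  rw [Am_apply, norm_mul, Complex.norm_real, mul_pow, Real.norm_eq_abs, abs_mul, abs_of_pos (by positivity)]
  have := ha k
  gcongr

lemma contDiff_Qf (av : Fin n → ℝ) {k : WithTop ℕ∞} : ContDiff ℝ k (Qf av) := by
  unfold Qf
  refine contDiff_const.mul (ContDiff.sum fun i _ => contDiff_const.mul ?_)
  have h : ContDiff ℝ k (fun z : V n => z i) := by fun_prop
  exact h.norm_sq ℝ

lemma Qf_lower (av : Fin n → ℝ) (m : ℝ) (h : ∀ k, m ≤ av k) (z : V n) : π * m * ‖z‖ ^ 2 ≤ Qf av z := by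
  have hpi := Real.pi_pos
  rw [Qf, EuclideanSpace.norm_sq_eq, mul_assoc, Finset.mul_sum]
  refine mul_le_mul_of_nonneg_left (Finset.sum_le_sum fun k _ => ?_) hpi.le
  have := h k
  gcongr

lemma hasGradient_Qf (av : Fin n → ℝ) (z : V n) :
    HasFDerivAt (Qf av) (innerSL ℝ (Am av z)) z := by
  have hd := ((contDiff_Qf av (k := 1)).differentiable (by norm_num) z).hasFDerivAt
  have : fderiv ℝ (Qf av) z = innerSL ℝ (Am av z) := by
    ext v
    have h1 : HasDerivAt (fun t : ℝ => Qf av (z + t • v)) (fderiv ℝ (Qf av) z v) 0 := by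
      have hl : HasDerivAt (fun t : ℝ => z + t • v) v 0 := by
        simpa using ((hasDerivAt_id (0:ℝ)).smul_const v).const_add z
      have hd' : HasFDerivAt (Qf av) (fderiv ℝ (Qf av) z) (z + (0:ℝ) • v) := by simpa using hd
      exact hd'.comp_hasDerivAt _ hl
    have h2 : HasDerivAt (fun t : ℝ => Qf av (z + t • v)) (inner ℝ (Am av z) v) 0 := by
      have e : (fun t : ℝ => Qf av (z + t • v)) = fun t => Qf av z + t * inner ℝ (Am av z) v + t ^ 2 * Qf av v := by
        funext t
        rw [Qf_add, inner_smul_right]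
        congr 1
        simp only [Qf, PiLp.smul_apply, norm_smul, mul_pow, Real.norm_eq_abs, sq_abs, Finset.mul_sum]
        exact Finset.sum_congr rfl fun i _ => by ring
      rw [e]
      have := (((hasDerivAt_id (0:ℝ)).mul_const (inner ℝ (Am av z) v)).const_add (Qf av z)).add
        (((hasDerivAt_id (0:ℝ)).pow 2).mul_const (Qf av v))
      refine HasDerivAt.congr_deriv (f' := _) this ?_
      simp
    simpa using h1.unique h2
  rwa [this] at hd

lemma lip_grad (S : V n → ℝ) (hS : ContDiff ℝ 2 S) (hc : HasCompactSupport S) :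
    ∃ L : ℝ, 0 < L ∧ (∀ z w, ‖gradient S z - gradient S w‖ ≤ L * ‖z - w‖) ∧ (∀ z, ‖gradient S z‖ ≤ L) ∧
      ∀ z, |S z| ≤ L := by
  have hf : ContDiff ℝ 1 (fderiv ℝ S) := hS.fderiv_right (by norm_num)
  have hfc : HasCompactSupport (fderiv ℝ S) := hc.fderiv ℝ
  obtain ⟨K, hK⟩ := hf.lipschitzWith_of_hasCompactSupport hfc (by norm_num)
  obtain ⟨K2, hK2⟩ := hfc.exists_bound_of_continuous hf.continuous
  obtain ⟨K3, hK3⟩ := hc.exists_bound_of_continuous hS.continuous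
  have hK20 : 0 ≤ K2 := (norm_nonneg _).trans (hK2 0)
  have hK30 : 0 ≤ K3 := (norm_nonneg _).trans (hK3 0)
  have hK0 : (0:ℝ) ≤ K := K.2
  refine ⟨K + K2 + K3 + 1, by positivity, ?_, ?_, ?_⟩
  · intro z w
    unfold gradient
    rw [← map_sub, LinearIsometryEquiv.norm_map]
    have := hK.dist_le_mul z w
    rw [dist_eq_norm, dist_eq_norm] at this
    nlinarith [norm_nonneg (z - w)]
  · intro z
    unfold gradient
    rw [LinearIsometryEquiv.norm_map]
    linarith [hK2 z]
  · intro z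
    have := hK3 z
    rw [Real.norm_eq_abs] at this
    linarith

lemma inner_gradient (S : V n → ℝ) (z v : V n) : inner ℝ (gradient S z) v = fderiv ℝ S z v := by
  unfold gradient
  rw [InnerProductSpace.toDual_symm_apply]

lemma quad_grad (S : V n → ℝ) (hS : ContDiff ℝ 2 S) (L : ℝ)
    (hL : ∀ z w, ‖gradient S z - gradient S w‖ ≤ L * ‖z - w‖) (z v : V n) :
    S z + inner ℝ (gradient S z) v - L * ‖v‖ ^ 2 ≤ S (z + v) := by
  have hd : Differentiable ℝ S := hS.differentiable (by norm_num)
  have hder : ∀ t : ℝ, HasDerivAt (fun t : ℝ => S (z + t • v)) (inner ℝ (gradient S (z + t • v)) v) t := by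
    intro t
    rw [inner_gradient]
    have hl : HasDerivAt (fun t : ℝ => z + t • v) v t := by
      simpa using ((hasDerivAt_id t).smul_const v).const_add z
    exact (hd _).hasFDerivAt.comp_hasDerivAt _ hl
  obtain ⟨t, ht, hte⟩ := exists_hasDerivAt_eq_slope (fun t : ℝ => S (z + t • v)) _ (zero_lt_one' ℝ)
    (fun t _ => (hder t).continuousAt.continuousWithinAt) (fun t _ => hder t)
  simp only [zero_smul, add_zero, one_smul, sub_zero, div_one] at hte
  have h1 : inner ℝ (gradient S z) v - inner ℝ (gradient S (z + t • v)) v ≤ L * ‖v‖ ^ 2 := by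
    rw [← inner_sub_left]
    refine (real_inner_le_norm _ _).trans ?_
    have h2 := hL z (z + t • v)
    have h3 : ‖z - (z + t • v)‖ ≤ ‖v‖ := by
      rw [sub_add_cancel_left, norm_neg, norm_smul, Real.norm_eq_abs, abs_of_pos ht.1]
      nlinarith [norm_nonneg v, ht.2]
    have h4 := norm_nonneg (gradient S z - gradient S (z + t • v))
    rcases le_or_gt 0 L with hL0 | hL0
    · calc _ ≤ (L * ‖v‖) * ‖v‖ := by
            gcongr
            exact h2.trans (by gcongr)
        _ = _ := by ring
    · have : L * ‖z - (z + t • v)‖ ≤ 0 := mul_nonpos_of_nonpos_of_nonneg hL0.le (norm_nonneg _)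
      have h5 : ‖z - (z + t • v)‖ = 0 := by
        by_contra hne
        have : 0 < ‖z - (z + t • v)‖ := lt_of_le_of_ne (norm_nonneg _) (Ne.symm hne)
        nlinarith
      rw [sub_add_cancel_left, norm_neg, norm_smul, Real.norm_eq_abs, abs_of_pos ht.1] at h5
      have : ‖v‖ = 0 := by
        rcases mul_eq_zero.1 h5 with h | h
        · linarith [ht.1]
        · exact h
      simp [this]
  linarith

lemma goodHam_of (i0 : Fin n) (H S : V n → ℝ) (av : Fin n → ℝ) (p : V n) (k0 m : ℝ)
    (hS : ContDiff ℝ 2 S) (hc : HasCompactSupport S) (hH : ∀ z, H z = Qf av z + k0 + S z)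
    (hnn : ∀ z, 0 ≤ H z) (hp : ∀ᶠ z in nhds p, H z = 0)
    (hm : 0 < m) (av1 : ∀ k, m ≤ av k) (av2 : 1 + m ≤ av i0) (av3 : av i0 ≤ 2 - m)
    (av4 : ∀ k, k ≠ i0 → av k ≤ 1 - m) :
    ∃ L C, GoodHam i0 H (fun z => Am av z + gradient S z) av p L C m := by
  have hpi := Real.pi_pos
  obtain ⟨L, hL, hL1, hL2, hL3⟩ := lip_grad S hS hc
  have hav : ∀ k, |av k| ≤ 2 := by
    intro k
    have h1 := av1 k
    rw [abs_of_pos (by linarith)]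
    by_cases hk : k = i0
    · subst hk; linarith
    · have := av4 k hk; linarith
  have hHc : Continuous H := by
    have : H = fun z => Qf av z + k0 + S z := funext hH
    rw [this]
    exact ((contDiff_Qf av (k := 2)).continuous.add continuous_const).add hS.continuous
  obtain ⟨ε, hε, hball⟩ := Metric.eventually_nhds_iff.1 hp
  have hup : ∀ z, H z ≤ (8 * π) * ‖z - p‖ ^ 2 + (8 * π * ‖p‖ ^ 2 + |k0| + L) := by
    intro z
    rw [hH]
    have h1 : Qf av z ≤ 4 * π * ‖z‖ ^ 2 / 2 := by
      rw [Qf_eq]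
      have := real_inner_le_norm (Am av z) z
      have h2 := norm_Am_le av 2 hav (by norm_num) z
      nlinarith [norm_nonneg z]
    have h2 : ‖z‖ ^ 2 ≤ 2 * ‖z - p‖ ^ 2 + 2 * ‖p‖ ^ 2 := by
      have : ‖z‖ ≤ ‖z - p‖ + ‖p‖ := by simpa using norm_add_le (z - p) p
      nlinarith [norm_nonneg z, sq_nonneg (‖z - p‖ - ‖p‖)]
    have h3 := le_abs_self k0
    have h4 := (abs_le.1 (hL3 z)).2
    nlinarith [norm_nonneg (z - p), norm_nonneg p, mul_nonneg hpi.le (sq_nonneg ‖z - p‖),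
      mul_nonneg hpi.le (sq_nonneg ‖p‖), mul_le_mul_of_nonneg_left h2 hpi.le]
  set D : ℝ := 8 * π * ‖p‖ ^ 2 + |k0| + L with hD
  have hD0 : 0 < D := by positivity
  set C : ℝ := L + |k0| + 8 * π / ε ^ 2 + D / ε ^ 4 + 1 with hC
  have hC1 : L + |k0| ≤ C := by
    have : 0 ≤ 8 * π / ε ^ 2 := by positivity
    have : 0 ≤ D / ε ^ 4 := by positivity
    linarith
  have hC2 : 8 * π / ε ^ 2 + D / ε ^ 4 ≤ C := by
    have := abs_nonneg k0
    linarith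
  have hCpos : 0 < C := by positivity
  refine ⟨L + 4 * π, C, ?_⟩
  refine ⟨hCpos, by positivity, hm, hHc, ?_, ?_, hnn, ?_, ?_, ?_, av1, av2, av3, av4⟩
  · intro z w
    have h1 : Am av z + gradient S z - (Am av w + gradient S w) = Am av (z - w) + (gradient S z - gradient S w) := by
      rw [Am_sub]; abel
    rw [h1]
    refine (norm_add_le _ _).trans ?_
    have h2 := norm_Am_le av 2 hav (by norm_num) (z - w)
    have h3 := hL1 z w
    linarith
  · intro z v
    have h1 := quad_grad S hS L hL1 z v
    have h2 := Qf_add av z v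
    have h3 : 0 ≤ Qf av v := le_trans (by positivity) (Qf_lower av m av1 v)
    rw [inner_add_left, hH, hH]
    nlinarith [sq_nonneg ‖v‖, mul_nonneg hpi.le (sq_nonneg ‖v‖)]
  · intro z
    rcases lt_or_ge (dist z p) ε with hz | hz
    · rw [hball hz]; positivity
    · rw [dist_eq_norm] at hz
      refine (hup z).trans ?_
      have e1 : 1 ≤ ‖z - p‖ / ε := by rwa [le_div_iff₀ hε, one_mul]
      set u := ‖z - p‖ / ε with hu
      have e2 : ‖z - p‖ = u * ε := by rw [hu]; field_simp
      have u2 : 1 ≤ u ^ 2 := one_le_pow₀ e1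
      have u4 : 1 ≤ u ^ 4 := one_le_pow₀ e1
      calc 8 * π * ‖z - p‖ ^ 2 + D ≤ (8 * π * ‖z - p‖ ^ 2) * u ^ 2 + D * u ^ 4 := by
            have : 0 ≤ 8 * π * ‖z - p‖ ^ 2 := by positivity
            nlinarith
        _ = (8 * π / ε ^ 2 + D / ε ^ 4) * ‖z - p‖ ^ 4 := by
            rw [e2]; field_simp
        _ ≤ C * ‖z - p‖ ^ 4 := by gcongr
  · intro z
    rw [← Qf_eq, hH]
    have h4 := (abs_le.1 (hL3 z)).1
    have h5 := neg_abs_le k0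
    linarith
  · intro z
    simp only [add_sub_cancel_left]
    have := abs_nonneg k0
    linarith [hL2 z]

end GNS

namespace GNS
variable {n : ℕ}

lemma uniq_orbit {i0 : Fin n} {H : V n → ℝ} {G : V n → V n} {av : Fin n → ℝ} {p : V n}
    {L C m : ℝ} (h : GoodHam i0 H G av p L C m) (y γ : ℝ → V n) (hy : Continuous y)
    (hy' : ∀ t ∈ Set.Icc (0:ℝ) 1, HasDerivAt y (Complex.I • G (y t)) t)
    (hγ' : ∀ t, HasDerivAt γ (Complex.I • G (γ t)) t) (h0 : y 0 = γ 0) :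
    ∀ t ∈ Set.Icc (0:ℝ) 1, y t = γ t := by
  have hl : LipschitzWith (Real.toNNReal L) (fun z => Complex.I • G z) := by
    refine LipschitzWith.of_dist_le_mul fun z w => ?_
    rw [Real.coe_toNNReal _ h.Lpos.le, dist_eq_norm, dist_eq_norm, ← smul_sub, norm_smul, Complex.norm_I, one_mul]
    exact h.lip z w
  have hγ : Continuous γ := continuous_iff_continuousAt.2 fun t => (hγ' t).continuousAt
  exact ODE_solution_unique (v := fun _ z => Complex.I • G z) (fun _ => hl) hy.continuousOn
    (fun t ht => (hy' t ⟨ht.1, ht.2.le⟩).hasDerivWithinAt) hγ.continuousOn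
    (fun t _ => (hγ' t).hasDerivWithinAt) h0

lemma action_const (H : V n → ℝ) (G : V n → V n) (y : ℝ → V n) (α β : ℝ)
    (h1 : ∀ t ∈ Set.Icc (0:ℝ) 1, inner ℝ (G (y t)) (y t) = α) (h2 : ∀ t ∈ Set.Icc (0:ℝ) 1, H (y t) = β)
    (hpos : 0 < (1/2) * (∫ t in (0:ℝ)..1, inner ℝ (G (y t)) (y t)) - ∫ t in (0:ℝ)..1, H (y t)) :
    0 < α / 2 - β := by
  have e1 : (∫ t in (0:ℝ)..1, inner ℝ (G (y t)) (y t)) = α := by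
    rw [intervalIntegral.integral_congr (g := fun _ => α)]
    · simp
    · intro t ht
      rw [Set.uIcc_of_le zero_le_one] at ht
      exact h1 t ht
  have e2 : (∫ t in (0:ℝ)..1, H (y t)) = β := by
    rw [intervalIntegral.integral_congr (g := fun _ => β)]
    · simp
    · intro t ht
      rw [Set.uIcc_of_le zero_le_one] at ht
      exact h2 t ht
  rw [e1, e2] at hpos
  linarith

/-- Unit complex rotation. -/
noncomputable def rot (s t : ℝ) : ℂ := Complex.exp ((2 * π * s * t : ℝ) * Complex.I)

lemma rot_zero (s : ℝ) : rot s 0 = 1 := by simp [rot]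

lemma norm_rot (s t : ℝ) : ‖rot s t‖ = 1 := by
  rw [rot, Complex.norm_exp_ofReal_mul_I]

lemma hasDerivAt_rot (s t : ℝ) : HasDerivAt (rot s) (Complex.I * ((2 * π * s : ℝ) : ℂ) * rot s t) t := by
  have h1 : HasDerivAt (fun t : ℝ => ((2 * π * s * t : ℝ) : ℂ) * Complex.I) (((2 * π * s : ℝ) : ℂ) * Complex.I) t := by
    have : HasDerivAt (fun t : ℝ => 2 * π * s * t) (2 * π * s) t := by
      simpa using (hasDerivAt_id t).const_mul (2 * π * s)
    exact this.ofReal_comp.mul_const Complex.I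
  refine HasDerivAt.congr_deriv (f := rot s) h1.cexp ?_
  simp only [rot]
  ring

lemma rot_one_eq (s : ℝ) (h : rot s 1 = 1) : ∃ k : ℤ, s = k := by
  rw [rot, Complex.exp_eq_one_iff] at h
  obtain ⟨k, hk⟩ := h
  refine ⟨k, ?_⟩
  have hpi : (π : ℂ) ≠ 0 := by exact_mod_cast Real.pi_ne_zero
  have hI := Complex.I_ne_zero
  have : ((s : ℝ) : ℂ) = ((k : ℝ) : ℂ) := by
    push_cast at hk ⊢
    have h2 : (2 * (π:ℂ) * Complex.I) * (s:ℂ) = (2 * (π:ℂ) * Complex.I) * k := by linear_combination hk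
    exact mul_left_cancel₀ (by simp) h2
  exact_mod_cast this

lemma rot_frac (s : ℝ) (h0 : 0 ≤ s) (h1 : s < 1) (h : rot s 1 = 1) : s = 0 := by
  obtain ⟨k, hk⟩ := rot_one_eq s h
  rw [hk] at h0 h1
  have a : 0 ≤ k := by exact_mod_cast h0
  have b : k < 1 := by exact_mod_cast h1
  have : k = 0 := by omega
  rw [hk, this]; simp

/-- Rotation flow of the quadratic Hamiltonian. -/
noncomputable def flow (av : Fin n → ℝ) (lam : ℝ) (z : V n) (t : ℝ) : V n :=
  WithLp.toLp 2 (fun k => rot (av k * lam) t * z k)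

lemma flow_apply (av : Fin n → ℝ) (lam : ℝ) (z : V n) (t : ℝ) (k : Fin n) :
    flow av lam z t k = rot (av k * lam) t * z k := rfl

lemma flow_zero (av : Fin n → ℝ) (lam : ℝ) (z : V n) : flow av lam z 0 = z := by
  ext k; simp [flow_apply, rot_zero]

lemma Qf_flow (av : Fin n → ℝ) (lam : ℝ) (z : V n) (t : ℝ) : Qf av (flow av lam z t) = Qf av z := by
  simp [Qf, flow_apply, norm_rot]

lemma hasDerivAt_flow (av : Fin n → ℝ) (lam : ℝ) (z : V n) (t : ℝ) :
    HasDerivAt (flow av lam z) (Complex.I • (lam • Am av (flow av lam z t))) t := by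
  rw [hasDerivAt_iff_hasFDerivAt, ← hasFDerivWithinAt_univ, hasFDerivWithinAt_piLp]
  intro k
  have := (hasDerivAt_rot (av k * lam) t).mul_const (z k)
  rw [hasFDerivWithinAt_univ]
  refine HasFDerivAt.congr_fderiv (f := fun t => flow av lam z t k) this.hasFDerivAt ?_
  ext
  simp [Am_apply, flow_apply]
  ring

lemma no_orbit {i0 : Fin n} {H : V n → ℝ} {G : V n → V n} {av : Fin n → ℝ} {p : V n}
    {L C m : ℝ} (h : GoodHam i0 H G av p L C m) (φ : V n → V n) (U1 : Set (V n))
    (hrot : ∀ w ∈ U1, ∀ u : ℂ, ‖u‖ = 1 → u • w ∈ U1)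
    (hd : ∀ w ∈ U1, DifferentiableAt ℝ φ w) (hinj : Set.InjOn φ U1)
    (h' : ℝ → ℝ) (h'0 : ∀ s, 0 ≤ h' s) (h'1 : ∀ s, h' s < 1)
    (f f' : ℝ → ℝ) (f0 : ∀ s, 0 ≤ f s) (f'0 : ∀ s, 0 ≤ f' s) (f'1 : ∀ s, f' s ≤ 1) (c ℓ m0 : ℝ)
    (fz : ∀ s, s ≤ 0 → f' s = 0) (fo : ∀ s, ℓ ≤ s → f' s = 1)
    (hav : av i0 = 4/3) (hc : 0 < c)
    (hG1 : ∀ w ∈ U1, fderiv ℝ φ w (Complex.I • ((2 * π * h' (π * ‖w‖ ^ 2)) • w)) = Complex.I • G (φ w))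
    (hQ : ∀ w ∈ U1, Qf av (φ w) < c)
    (hG2 : ∀ z, z ∉ φ '' U1 → G z = f' (Qf av z - c) • Am av z ∧ H z = m0 + f (Qf av z - c))
    (hℓ : (3/4) * (c + ℓ) ≤ m0) : False := by
  obtain ⟨y, hyc, hy01, hy', hpos⟩ := periodic_orbit h
  have case1 : G (y 0) ≠ 0 := by
    intro hG0
    have hcst := uniq_orbit h y (fun _ => y 0) hyc hy' (fun t => by
      simpa [hG0] using hasDerivAt_const t (y 0)) rfl
    have := action_const H G y 0 (H (y 0)) (fun t ht => by rw [hcst t ht, hG0, inner_zero_left])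
      (fun t ht => by rw [hcst t ht]) hpos
    linarith [h.nonneg (y 0)]
  by_cases hy0 : y 0 ∈ φ '' U1
  · obtain ⟨w, hw, hwy⟩ := hy0
    set s := h' (π * ‖w‖ ^ 2) with hs
    have hmem : ∀ t, rot s t • w ∈ U1 := fun t => hrot w hw _ (norm_rot s t)
    have hnorm : ∀ t, ‖rot s t • w‖ = ‖w‖ := fun t => by rw [norm_smul, norm_rot, one_mul]
    have hγ : ∀ t, HasDerivAt (fun t => φ (rot s t • w)) (Complex.I • G (φ (rot s t • w))) t := by
      intro t
      have h1 := (hasDerivAt_rot s t).smul_const w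
      have h2 := (hd _ (hmem t)).hasFDerivAt.comp_hasDerivAt t h1
      rw [← hG1 _ (hmem t), hnorm, ← hs]
      refine HasDerivAt.congr_deriv (f := fun t => φ (rot s t • w)) h2 ?_
      congr 1
      rw [← Complex.coe_smul, smul_smul, smul_smul]
    have heq := uniq_orbit h y _ hyc hy' hγ (by simp [rot_zero, hwy])
    have h1 := heq 1 (by simp)
    rw [← hy01, ← hwy] at h1
    have h2 := hinj hw (hmem 1) h1
    have hz : s • w = 0 := by
      by_cases hw0 : w = 0
      · simp [hw0]
      · have h3 : (rot s 1 - 1) • w = 0 := by rw [sub_smul, one_smul, ← h2, sub_self]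
        rcases smul_eq_zero.1 h3 with h4 | h4
        · rw [rot_frac s (h'0 _) (h'1 _) (sub_eq_zero.1 h4), zero_smul]
        · exact absurd h4 hw0
    have h5 := hG1 w hw
    rw [← hs, mul_smul, hz, smul_zero, smul_zero, map_zero] at h5
    rw [← hwy] at case1
    exact case1 ((smul_eq_zero.1 h5.symm).resolve_left Complex.I_ne_zero)
  · obtain ⟨hGy, hHy⟩ := hG2 _ hy0
    set lam := f' (Qf av (y 0) - c) with hlam
    have hlne : lam ≠ 0 := by
      intro h0
      rw [h0, zero_smul] at hGy
      exact case1 hGy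
    have hlpos : 0 < lam := lt_of_le_of_ne (f'0 _) (Ne.symm hlne)
    have hQy : c < Qf av (y 0) := by
      by_contra hcon
      exact hlne (fz _ (by linarith [not_lt.1 hcon]))
    have hout : ∀ t, flow av lam (y 0) t ∉ φ '' U1 := by
      rintro t ⟨w, hw, hwe⟩
      have := hQ w hw
      rw [hwe, Qf_flow] at this
      linarith
    have hγ : ∀ t, HasDerivAt (flow av lam (y 0)) (Complex.I • G (flow av lam (y 0) t)) t := by
      intro t
      rw [(hG2 _ (hout t)).1, Qf_flow, ← hlam]
      exact hasDerivAt_flow av lam (y 0) t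
    have heq := uniq_orbit h y _ hyc hy' hγ (flow_zero _ _ _).symm
    have h1 := heq 1 (by simp)
    have hk : ∀ k, y 0 k ≠ 0 → rot (av k * lam) 1 = 1 := by
      intro k hne
      have h2 : y 1 k = rot (av k * lam) 1 * y 0 k := by
        conv_lhs => rw [h1]
        rfl
      rw [← hy01] at h2
      have h3 : (rot (av k * lam) 1 - 1) * y 0 k = 0 := by linear_combination -h2
      exact sub_eq_zero.1 ((mul_eq_zero.1 h3).resolve_right hne)
    have hk0 : ∀ k, k ≠ i0 → y 0 k = 0 := by
      intro k hki
      by_contra hne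
      have h2 := h.av1 k
      have h3 := h.av4 k hki
      have h4 := h.mpos
      have h5 := f'1 (Qf av (y 0) - c)
      have hp : 0 < av k * lam := mul_pos (by linarith) hlpos
      have := rot_frac (av k * lam) hp.le (by nlinarith) (hk k hne)
      linarith
    have hi0 : y 0 i0 ≠ 0 := by
      intro hz
      have : Qf av (y 0) = 0 := by
        rw [Qf, Finset.sum_eq_zero, mul_zero]
        intro k _
        by_cases hki : k = i0
        · simp [hki, hz]
        · simp [hk0 k hki]
      linarith
    obtain ⟨k, hk1⟩ := rot_one_eq _ (hk i0 hi0)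
    rw [hav] at hk1
    have hl1 : lam ≤ 1 := f'1 _
    have hkk : k = 1 := by
      have a : (0:ℝ) < k := by rw [← hk1]; linarith
      have b : (k:ℝ) < 2 := by rw [← hk1]; linarith
      have a' : 0 < k := by exact_mod_cast a
      have b' : k < 2 := by exact_mod_cast b
      omega
    rw [hkk] at hk1
    have hl34 : lam = 3/4 := by push_cast at hk1; linarith
    have hQl : Qf av (y 0) - c < ℓ := by
      by_contra hcon
      have := fo _ (not_lt.1 hcon)
      rw [← hlam] at this
      linarith
    have hfin := action_const H G y (2 * lam * Qf av (y 0)) (m0 + f (Qf av (y 0) - c))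
      (fun t ht => by
        rw [heq t ht, (hG2 _ (hout t)).1, Qf_flow, ← hlam, real_inner_smul_left]
        have := Qf_eq av (flow av lam (y 0) t)
        rw [Qf_flow] at this
        rw [this]; ring)
      (fun t ht => by rw [heq t ht, (hG2 _ (hout t)).2, Qf_flow]) hpos
    have := f0 (Qf av (y 0) - c)
    rw [hl34] at hfin
    linarith

end GNS

namespace GNS
variable {n : ℕ}

lemma equiv_of_symp (A : V n →L[ℝ] V n)
    (hA : ∀ v w, inner ℝ (Complex.I • A v) (A w) = inner ℝ (Complex.I • v) w) :
    ∃ e : V n ≃L[ℝ] V n, (e : V n →L[ℝ] V n) = A := by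
  have hinj : Function.Injective (A : V n →ₗ[ℝ] V n) := by
    rw [injective_iff_map_eq_zero]
    intro v hv
    have hv' : A v = 0 := hv
    have h1 := hA v (Complex.I • v)
    rw [hv', smul_zero, inner_zero_left] at h1
    have h2 := inner_self_eq_zero.1 h1.symm
    exact (smul_eq_zero.1 h2).resolve_left Complex.I_ne_zero
  refine ⟨(LinearEquiv.ofInjectiveEndo (A : V n →ₗ[ℝ] V n) hinj).toContinuousLinearEquiv, ?_⟩
  ext v
  rfl

lemma pushforward (φ : V n → V n) (U K : Set (V n)) (g : V n → ℝ) (hU : IsOpen U)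
    (hφ : ContDiffOn ℝ 2 φ U) (hinj : Set.InjOn φ U)
    (hE : ∀ x ∈ U, ∃ e : V n ≃L[ℝ] V n, (e : V n →L[ℝ] V n) = fderiv ℝ φ x)
    (hK : IsCompact K) (hKU : K ⊆ U) (hg : ContDiff ℝ 2 g) (g0 : ∀ w, w ∉ K → g w = 0) :
    ∃ P : V n → ℝ, ContDiff ℝ 2 P ∧ (∀ w ∈ U, P (φ w) = g w) ∧ ∀ z, z ∉ φ '' K → P z = 0 := by
  classical
  set P : V n → ℝ := fun z => if z ∈ φ '' U then g (Function.invFunOn φ U z) else 0 with hP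
  have hP1 : ∀ w ∈ U, P (φ w) = g w := by
    intro w hw
    simp only [hP]
    rw [if_pos ⟨w, hw, rfl⟩, hinj.leftInvOn_invFunOn hw]
  have hP2 : ∀ z, z ∉ φ '' K → P z = 0 := by
    intro z hz
    by_cases hzU : z ∈ φ '' U
    · obtain ⟨w, hw, rfl⟩ := hzU
      rw [hP1 w hw]
      exact g0 w fun hwK => hz ⟨w, hwK, rfl⟩
    · simp only [hP]
      rw [if_neg hzU]
  refine ⟨P, ?_, hP1, hP2⟩
  rw [contDiff_iff_contDiffAt]
  intro z
  by_cases hzU : z ∈ φ '' U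
  · obtain ⟨w, hw, rfl⟩ := hzU
    obtain ⟨e, he⟩ := hE w hw
    have hat : ContDiffAt ℝ 2 φ w := hφ.contDiffAt (hU.mem_nhds hw)
    have hst : HasStrictFDerivAt φ (e : V n →L[ℝ] V n) w := by
      rw [he]
      exact hat.hasStrictFDerivAt (by norm_num)
    have hinv : ContDiffAt ℝ 2 (HasStrictFDerivAt.localInverse φ e w hst) (φ w) :=
      hat.to_localInverse hst.hasFDerivAt (by norm_num)
    have h1 := hst.eventually_right_inverse
    have h2 := hst.localInverse_tendsto.eventually (hU.mem_nhds hw)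
    have h3 : P =ᶠ[nhds (φ w)] fun z => g (HasStrictFDerivAt.localInverse φ e w hst z) := by
      filter_upwards [h1, h2] with z hz1 hz2
      conv_lhs => rw [← hz1]
      exact hP1 _ hz2
    exact (hg.contDiffAt.comp (φ w) hinv).congr_of_eventuallyEq h3
  · have hcl : IsClosed (φ '' K) := (hK.image_of_continuousOn (hφ.continuousOn.mono hKU)).isClosed
    have hz : z ∈ (φ '' K)ᶜ := fun ⟨w, hw, hwz⟩ => hzU ⟨w, hKU hw, hwz⟩
    have h3 : P =ᶠ[nhds z] fun _ => 0 := by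
      filter_upwards [hcl.isOpen_compl.mem_nhds hz] with z' hz'
      exact hP2 z' hz'
    exact contDiffAt_const.congr_of_eventuallyEq h3

lemma compact_ball (s : ℝ) : IsCompact {w : V n | π * ‖w‖ ^ 2 ≤ s} := by
  refine Metric.isCompact_of_isClosed_isBounded (isClosed_le (by fun_prop) continuous_const) ?_
  refine (Metric.isBounded_closedBall (x := (0 : V n)) (r := |s| + 1)).subset ?_
  intro w hw
  rw [mem_closedBall_zero_iff]
  have hw' : π * ‖w‖ ^ 2 ≤ s := hw
  have := Real.pi_gt_three
  nlinarith [le_abs_self s, abs_nonneg s, norm_nonneg w, sq_nonneg (‖w‖ - 1), mul_nonneg (by linarith : 0 ≤ π - 3) (sq_nonneg ‖w‖)]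

lemma hasFDerivAt_radial (h h' : ℝ → ℝ) (hd : ∀ s, HasDerivAt h (h' s) s) (w : V n) :
    HasFDerivAt (fun w : V n => h (π * ‖w‖ ^ 2)) ((2 * π * h' (π * ‖w‖ ^ 2)) • innerSL ℝ w) w := by
  have h1 : HasFDerivAt (fun w : V n => π * ‖w‖ ^ 2) (π • (2 • innerSL ℝ w)) w :=
    (hasStrictFDerivAt_norm_sq w).hasFDerivAt.const_mul π
  refine HasFDerivAt.congr_fderiv (f := fun w : V n => h (π * ‖w‖ ^ 2)) ((hd _).comp_hasFDerivAt w h1) ?_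
  ext v
  simp
  ring

theorem nonsq (i0 : Fin n) (r R : ℝ) (hR : 0 < R) (hRr : R < r) (φ : V n → V n)
    (hφ : ContDiffOn ℝ 2 φ {w | π * ‖w‖ ^ 2 < r}) (hinj : Set.InjOn φ {w | π * ‖w‖ ^ 2 < r})
    (hmaps : ∀ w, π * ‖w‖ ^ 2 < r → π * ‖φ w i0‖ ^ 2 < R)
    (hω : ∀ x, π * ‖x‖ ^ 2 < r → ∀ v w, inner ℝ (Complex.I • (fderiv ℝ φ x v)) (fderiv ℝ φ x w)
      = inner ℝ (Complex.I • v) w) : False := by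
  have hpi := Real.pi_pos
  set U : Set (V n) := {w | π * ‖w‖ ^ 2 < r} with hUdef
  have hU : IsOpen U := isOpen_lt (by fun_prop) continuous_const
  obtain ⟨R', hR1, hR2⟩ := exists_between hRr
  obtain ⟨r1, hr1, hr2⟩ := exists_between hR2
  obtain ⟨h, h', m0, e, hhC, hhd, hh0, hh1, he0, heb, hhz, hhm, hm0, hhnn⟩ := exists_h R' r1 (hR.trans hR1) hr1
  set K : Set (V n) := {w | π * ‖w‖ ^ 2 ≤ r1 - e} with hKdef
  set B1 : Set (V n) := {w | π * ‖w‖ ^ 2 ≤ r1} with hB1def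
  set U1 : Set (V n) := {w | π * ‖w‖ ^ 2 < r1} with hU1def
  have hU1o : IsOpen U1 := isOpen_lt (by fun_prop) continuous_const
  have hKc : IsCompact K := compact_ball _
  have hB1c : IsCompact B1 := compact_ball _
  have hB1U : B1 ⊆ U := fun w hw => lt_of_le_of_lt (show π * ‖w‖ ^ 2 ≤ r1 from hw) hr2
  have hU1B1 : U1 ⊆ B1 := fun w hw => le_of_lt (show π * ‖w‖ ^ 2 < r1 from hw)
  have hU1U : U1 ⊆ U := hU1B1.trans hB1U
  have hKU1 : K ⊆ U1 := fun w hw => lt_of_le_of_lt (show π * ‖w‖ ^ 2 ≤ r1 - e from hw) (by linarith)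
  have hKU : K ⊆ U := hKU1.trans hU1U
  obtain ⟨M, hM⟩ := hB1c.exists_bound_of_continuousOn (hφ.continuousOn.mono hB1U)
  set a : ℝ := min (1/3) ((R' - R) / (π * (M ^ 2 + 1))) with ha
  have hRR : 0 < R' - R := by linarith
  have ha0 : 0 < a := lt_min (by norm_num) (by positivity)
  have ha1 : a ≤ 1/3 := min_le_left _ _
  have ha2 : π * a * (M ^ 2 + 1) ≤ R' - R := by
    have : a ≤ (R' - R) / (π * (M ^ 2 + 1)) := min_le_right _ _
    rw [le_div_iff₀ (by positivity)] at this
    linarith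
  set av : Fin n → ℝ := fun k => if k = i0 then 4/3 else a with hav
  have hav0 : av i0 = 4/3 := by simp [hav]
  have havk : ∀ k, k ≠ i0 → av k = a := fun k hk => by simp [hav, hk]
  have hava : ∀ k, a ≤ av k := by
    intro k
    by_cases hk : k = i0
    · rw [hk, hav0]; linarith
    · rw [havk k hk]
  set c : ℝ := 4/3 * R' with hc
  have hcpos : 0 < c := by rw [hc]; linarith
  have hQ : ∀ w ∈ B1, Qf av (φ w) < c := by
    intro w hw
    have h1 := hmaps w (hB1U hw)
    have h2 := hM w hw
    have h3 : Qf av (φ w) ≤ 4/3 * (π * ‖φ w i0‖ ^ 2) + π * a * ‖φ w‖ ^ 2 := by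
      rw [Qf, EuclideanSpace.norm_sq_eq, Finset.mul_sum, Finset.mul_sum]
      have : ∀ k, π * (av k * ‖φ w k‖ ^ 2) ≤ (if k = i0 then 4/3 * (π * ‖φ w i0‖ ^ 2) else 0) + π * a * ‖φ w k‖ ^ 2 := by
        intro k
        by_cases hk : k = i0
        · subst hk
          rw [hav0, if_pos rfl]
          have : 0 ≤ π * a * ‖φ w k‖ ^ 2 := by positivity
          linarith
        · rw [havk k hk, if_neg hk]
          linarith
      refine (Finset.sum_le_sum fun k _ => this k).trans ?_
      rw [Finset.sum_add_distrib]
      simp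
    have h4 : ‖φ w‖ ^ 2 ≤ M ^ 2 + 1 := by nlinarith [norm_nonneg (φ w)]
    have h5 : π * a * ‖φ w‖ ^ 2 ≤ π * a * (M ^ 2 + 1) := by gcongr
    rw [hc]; linarith
  have hE : ∀ x ∈ U, ∃ e : V n ≃L[ℝ] V n, (e : V n →L[ℝ] V n) = fderiv ℝ φ x :=
    fun x hx => equiv_of_symp _ (hω x hx)
  have hgC : ContDiff ℝ 2 (fun w : V n => h (π * ‖w‖ ^ 2) - m0) := by
    refine ContDiff.sub ?_ contDiff_const
    exact hhC.comp (contDiff_const.mul (contDiff_id.norm_sq ℝ))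
  obtain ⟨P, hPC, hP1, hP2⟩ := pushforward φ U K (fun w => h (π * ‖w‖ ^ 2) - m0) hU hφ hinj hE hKc hKU hgC
    (fun w hw => by
      have : r1 - e < π * ‖w‖ ^ 2 := not_le.1 hw
      rw [hhm _ this.le, sub_self])
  have hφK : IsCompact (φ '' K) := hKc.image_of_continuousOn (hφ.continuousOn.mono hKU)
  have hPc : HasCompactSupport P := HasCompactSupport.intro hφK hP2
  set ℓ : ℝ := 4/3 * (m0 - R') with hℓ
  have hℓ0 : 0 < ℓ := by rw [hℓ]; linarith
  have hm0pos : 0 < m0 := by linarith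
  obtain ⟨f, f', hfC, hfd, hf'0, hf'1, hfz, hf'z, hf'o, hfl, hfnn⟩ := exists_f ℓ hℓ0
  set T : V n → ℝ := fun z => f (Qf av z - c) - (Qf av z - c) - (f ℓ - ℓ) with hT
  have hTC : ContDiff ℝ 2 T := by
    have h1 : ContDiff ℝ 2 (fun z => Qf av z - c) := (contDiff_Qf av).sub contDiff_const
    exact ((hfC.comp h1).sub h1).sub contDiff_const
  have hTc : HasCompactSupport T := by
    refine HasCompactSupport.intro (compact_ball ((c + ℓ) / a)) ?_
    intro z hz
    have h1 : (c + ℓ) / a < π * ‖z‖ ^ 2 := not_le.1 hz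
    rw [div_lt_iff₀ ha0] at h1
    have h2 := Qf_lower av a hava z
    have h3 : ℓ ≤ Qf av z - c := by linarith
    simp only [hT]
    rw [hfl _ h3]; ring
  set S : V n → ℝ := fun z => P z + T z with hS
  have hSC : ContDiff ℝ 2 S := hPC.add hTC
  have hSc : HasCompactSupport S := hPc.add hTc
  set H : V n → ℝ := fun z => m0 + f (Qf av z - c) + P z with hH
  have hHS : ∀ z, H z = Qf av z + (m0 + f ℓ - ℓ - c) + S z := by
    intro z
    simp only [hH, hS, hT]
    ring
  have hHφ : ∀ w ∈ U1, H (φ w) = h (π * ‖w‖ ^ 2) := by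
    intro w hw
    have h1 := hQ w (hU1B1 hw)
    simp only [hH]
    rw [hP1 w (hU1U hw), hfz _ (by linarith)]
    ring
  have hHnn : ∀ z, 0 ≤ H z := by
    intro z
    simp only [hH]
    have h1 := hfnn (Qf av z - c)
    by_cases hz : z ∈ φ '' K
    · obtain ⟨w, hw, rfl⟩ := hz
      rw [hP1 w (hKU hw)]
      linarith [hhnn (π * ‖w‖ ^ 2)]
    · rw [hP2 z hz]; linarith
  have h0U1 : (0 : V n) ∈ U1 := by
    show π * ‖(0 : V n)‖ ^ 2 < r1
    simp; linarith
  have hp : ∀ᶠ z in nhds (φ 0), H z = 0 := by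
    obtain ⟨e0, he0'⟩ := hE 0 (hU1U h0U1)
    have hst : HasStrictFDerivAt φ (e0 : V n →L[ℝ] V n) 0 := by
      rw [he0']
      exact (hφ.contDiffAt (hU.mem_nhds (hU1U h0U1))).hasStrictFDerivAt (by norm_num)
    rw [← hst.map_nhds_eq_of_equiv, Filter.eventually_map]
    have h1 : IsOpen {w : V n | π * ‖w‖ ^ 2 < e} := isOpen_lt (by fun_prop) continuous_const
    have h2 : (0 : V n) ∈ {w : V n | π * ‖w‖ ^ 2 < e} := by
      show π * ‖(0 : V n)‖ ^ 2 < e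
      simpa using he0
    filter_upwards [hU1o.mem_nhds h0U1, h1.mem_nhds h2] with w hw1 hw2
    rw [hHφ w hw1]
    exact hhz _ (le_of_lt hw2)
  obtain ⟨L, C, hgood⟩ := goodHam_of i0 H S av (φ 0) (m0 + f ℓ - ℓ - c) a hSC hSc hHS hHnn hp ha0 hava
    (by rw [hav0]; linarith) (by rw [hav0]; linarith) (fun k hk => by rw [havk k hk]; linarith)
  set G : V n → V n := fun z => Am av z + gradient S z with hG
  have hHd : ∀ z, HasFDerivAt H (innerSL ℝ (G z)) z := by
    intro z
    have h1 := (hasGradient_Qf av z).add_const (m0 + f ℓ - ℓ - c)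
    have h2 := (hSC.differentiable (by norm_num) z).hasFDerivAt
    have h3 := h1.add h2
    have hHe : H = fun z => Qf av z + (m0 + f ℓ - ℓ - c) + S z := funext hHS
    rw [hHe]
    refine HasFDerivAt.congr_fderiv (f := fun z => Qf av z + (m0 + f ℓ - ℓ - c) + S z) h3 ?_
    ext v
    simp [hG, inner_add_left, inner_gradient]
  refine no_orbit hgood φ U1 ?_ ?_ (hinj.mono hU1U) h' hh0 hh1 f f' hfnn hf'0 hf'1 c ℓ m0 hf'z hf'o hav0 hcpos
    ?_ (fun w hw => hQ w (hU1B1 hw)) ?_ (by rw [hc, hℓ]; linarith)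
  · intro w hw u hu
    show π * ‖u • w‖ ^ 2 < r1
    rw [norm_smul, hu, one_mul]
    exact hw
  · intro w hw
    exact (hφ.contDiffAt (hU.mem_nhds (hU1U hw))).differentiableAt (by norm_num)
  · intro w hw
    have hdφ : HasFDerivAt φ (fderiv ℝ φ w) w :=
      ((hφ.contDiffAt (hU.mem_nhds (hU1U hw))).differentiableAt (by norm_num)).hasFDerivAt
    have h1 := (hHd (φ w)).comp w hdφ
    have h2 := hasFDerivAt_radial h h' hhd w
    have h3 : (H ∘ φ) =ᶠ[nhds w] fun w => h (π * ‖w‖ ^ 2) := by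
      filter_upwards [hU1o.mem_nhds hw] with w' hw'
      exact hHφ w' hw'
    have h4 := h1.unique (h2.congr_of_eventuallyEq h3)
    have h5 : ∀ v, inner ℝ (G (φ w)) (fderiv ℝ φ w v) = 2 * π * h' (π * ‖w‖ ^ 2) * inner ℝ w v := by
      intro v
      have := congrArg (fun A : V n →L[ℝ] ℝ => A v) h4
      simpa using this
    obtain ⟨e0, he0'⟩ := hE w (hU1U hw)
    set X := Complex.I • ((2 * π * h' (π * ‖w‖ ^ 2)) • w) with hX
    have hIX : Complex.I • X = -((2 * π * h' (π * ‖w‖ ^ 2)) • w) := by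
      rw [hX, smul_smul, Complex.I_mul_I, neg_smul, one_smul]
    have h6 : Complex.I • fderiv ℝ φ w X + G (φ w) = 0 := by
      refine ext_inner_right ℝ fun u => ?_
      obtain ⟨v, hv⟩ := e0.surjective u
      have hv' : fderiv ℝ φ w v = u := by rw [← he0']; exact hv
      rw [← hv', inner_add_left, hω w (hU1U hw), h5, hIX, inner_neg_left, real_inner_smul_left, inner_zero_left]
      ring
    have h7 : Complex.I • (Complex.I • fderiv ℝ φ w X + G (φ w)) = 0 := by rw [h6, smul_zero]
    rw [smul_add, smul_smul, Complex.I_mul_I, neg_smul, one_smul] at h7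
    exact (neg_add_eq_zero.1 h7)
  · intro z hz
    have hzK : z ∉ φ '' K := fun ⟨w, hw, hwz⟩ => hz ⟨w, hKU1 hw, hwz⟩
    refine ⟨?_, by simp only [hH]; rw [hP2 z hzK, add_zero]⟩
    have h3 : H =ᶠ[nhds z] fun z => m0 + f (Qf av z - c) := by
      filter_upwards [hφK.isClosed.isOpen_compl.mem_nhds hzK] with z' hz'
      simp only [hH]
      rw [hP2 z' hz', add_zero]
    have h1 : HasFDerivAt (fun z => m0 + f (Qf av z - c)) (f' (Qf av z - c) • innerSL ℝ (Am av z)) z :=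
      ((hfd _).comp_hasFDerivAt z ((hasGradient_Qf av z).sub_const c)).const_add m0
    have h4 := (hHd z).unique (h1.congr_of_eventuallyEq h3)
    refine ext_inner_right ℝ fun u => ?_
    have := congrArg (fun A : V n →L[ℝ] ℝ => A u) h4
    rw [real_inner_smul_left]
    simpa using this

end GNS

/-- Gromov's non-squeezing theorem: the open ball of capacity `r` embeds
symplectically into the cylinder `Z^{2n}(R)` if and only if `r ≤ R`. -/
theorem gromov_nonsqueezing (n : ℕ) (hn : 1 ≤ n) (r R : ℝ) (hr : 0 < r) (hR : 0 < R) :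
    (∃ ψ, IsSymplecticEmbedding n
      {z : EuclideanSpace ℂ (Fin n) | π * ∑ k, ‖z k‖ ^ 2 < r}
      {z : EuclideanSpace ℂ (Fin n) | π * ‖z ⟨0, hn⟩‖ ^ 2 < R} ψ) ↔ r ≤ R := by
  constructor
  · rintro ⟨ψ, h1, h2, h3, h4⟩
    by_contra hcon
    have hset : {z : EuclideanSpace ℂ (Fin n) | π * ∑ k, ‖z k‖ ^ 2 < r}
        = {w : GNS.V n | π * ‖w‖ ^ 2 < r} := by
      ext z
      simp only [Set.mem_setOf_eq]
      rw [EuclideanSpace.norm_sq_eq]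
    rw [hset] at h1 h2 h3 h4
    have hom : ∀ v w : EuclideanSpace ℂ (Fin n), omegaStd n v w = inner ℝ (Complex.I • v) w := by
      intro v w
      simp only [omegaStd, PiLp.inner_apply, Complex.inner]
      refine Finset.sum_congr rfl fun k _ => ?_
      simp
      ring
    refine GNS.nonsq ⟨0, hn⟩ r R hR (not_le.1 hcon) ψ (h1.of_le ?_) h2 (fun w hw => h3 hw) ?_
    · exact WithTop.coe_le_coe.2 (le_top : (2 : ℕ∞) ≤ ⊤)
    · intro x hx v w
      rw [← hom, ← hom]
      exact h4 x hx v w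
  · intro hle
    refine ⟨id, contDiffOn_id, Function.injective_id.injOn, ?_, ?_⟩
    · intro z hz
      simp only [Set.mem_setOf_eq, id] at hz ⊢
      refine lt_of_le_of_lt ?_ (hz.trans_le hle)
      refine mul_le_mul_of_nonneg_left ?_ Real.pi_pos.le
      exact Finset.single_le_sum (f := fun k => ‖z k‖ ^ 2) (fun k _ => sq_nonneg _) (Finset.mem_univ _)
    · intro x _ v w
      simp
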